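/- Assume E(ξ log ξ) < ∞ and that F̄ is regularly varying at infinity with index −1. Then P{W > x} ~ Σ_{i=0}^{∞} m^i·F̄(m^{i+1}x) ~ (1/(m·log m))·x^{-1}·∫_x^{∞} F̄(u) du as x → ∞, where W is the almost sure limit of W_n. -/

import Mathlib

open MeasureTheory Filter ProbabilityTheory

lemma gw_sumlem {m : ℝ} (hm1 : 1 < m) (F1 F2 T : ℝ → ℝ)
    (hpos : ∀ᶠ y in atTop, 0 < F2 y)
    (hr : Tendsto (fun y => F1 y / F2 y) atTop (nhds 1))
    (hT : ∀ᶠ x in atTop, HasSum (fun i : ℕ => m ^ i * F1 (m ^ (i + 1) * x)) (T x)) :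
    (∀ᶠ x in atTop, Summable (fun i : ℕ => m ^ i * F2 (m ^ (i + 1) * x))) ∧
    Tendsto (fun x => T x / ∑' i : ℕ, m ^ i * F2 (m ^ (i + 1) * x)) atTop (nhds 1) := by
  have hm0 : 0 < m := by linarith
  have key : ∀ ε > 0, ∀ᶠ x in atTop, ∀ i : ℕ, 0 < F2 (m ^ (i + 1) * x) ∧
      |F1 (m ^ (i + 1) * x) - F2 (m ^ (i + 1) * x)| ≤ ε * F2 (m ^ (i + 1) * x) := by
    intro ε hε
    have h1 := hr.eventually (Metric.closedBall_mem_nhds (1 : ℝ) hε)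
    obtain ⟨X, hX⟩ := eventually_atTop.1 (hpos.and h1)
    filter_upwards [eventually_ge_atTop (max X 0)] with x hx i
    have hx0 : 0 ≤ x := le_trans (le_max_right _ _) hx
    have hge : X ≤ m ^ (i + 1) * x := by
      have : 1 ≤ m ^ (i + 1) := one_le_pow₀ hm1.le
      have h2 : x ≤ m ^ (i + 1) * x := le_mul_of_one_le_left hx0 this
      exact le_trans (le_trans (le_max_left _ _) hx) h2
    obtain ⟨h3, h4⟩ := hX _ hge
    refine ⟨h3, ?_⟩
    rw [Real.dist_eq] at h4
    have h5 : F1 (m ^ (i + 1) * x) - F2 (m ^ (i + 1) * x)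
        = (F1 (m ^ (i + 1) * x) / F2 (m ^ (i + 1) * x) - 1) * F2 (m ^ (i + 1) * x) := by
      field_simp
    rw [h5, abs_mul, abs_of_pos h3]
    exact mul_le_mul_of_nonneg_right h4 h3.le
  have hsum : ∀ᶠ x in atTop, Summable (fun i : ℕ => m ^ i * F2 (m ^ (i + 1) * x)) := by
    filter_upwards [key (1/2) (by norm_num), hT] with x hx hTx
    refine Summable.of_nonneg_of_le (fun i => ?_) (fun i => ?_) (hTx.summable.mul_left 2)
    · have := (hx i).1
      positivity
    · have h1 := (abs_le.1 (hx i).2).1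
      have h2 : F2 (m ^ (i + 1) * x) ≤ 2 * F1 (m ^ (i + 1) * x) := by linarith
      calc m ^ i * F2 (m ^ (i + 1) * x) ≤ m ^ i * (2 * F1 (m ^ (i + 1) * x)) := by gcongr
        _ = _ := by ring
  refine ⟨hsum, ?_⟩
  rw [Metric.tendsto_nhds]
  intro ε hε
  filter_upwards [key (ε/2) (by positivity), hsum, hT] with x hx hs hTx
  have hSpos : 0 < ∑' i : ℕ, m ^ i * F2 (m ^ (i + 1) * x) :=
    hs.tsum_pos (fun i => by have := (hx i).1; positivity) 0 (by have := (hx 0).1; positivity)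
  set S := ∑' i : ℕ, m ^ i * F2 (m ^ (i + 1) * x) with hS
  have hle : T x ≤ (1 + ε/2) * S := by
    refine hasSum_le (fun i => ?_) hTx (hs.hasSum.mul_left (1 + ε/2))
    have h1 := (abs_le.1 (hx i).2).2
    calc m ^ i * F1 (m ^ (i + 1) * x) ≤ m ^ i * ((1 + ε/2) * F2 (m ^ (i + 1) * x)) := by
          gcongr; linarith
      _ = _ := by ring
  have hge : (1 - ε/2) * S ≤ T x := by
    refine hasSum_le (fun i => ?_) (hs.hasSum.mul_left (1 - ε/2)) hTx
    have h1 := (abs_le.1 (hx i).2).1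
    calc _ = m ^ i * ((1 - ε/2) * F2 (m ^ (i + 1) * x)) := by ring
      _ ≤ m ^ i * F1 (m ^ (i + 1) * x) := by gcongr; linarith
  rw [Real.dist_eq, abs_lt]
  have e : T x / S - 1 = (T x - S) / S := by field_simp
  rw [e]
  constructor
  · rw [lt_div_iff₀ hSpos]; nlinarith
  · rw [div_lt_iff₀ hSpos]; nlinarith

lemma gw_weier {Ω : Type*} [MeasurableSpace Ω] (μ : Measure Ω)
    (w z : ℝ → Ω → ℝ) (hz : ∀ᶠ x in atTop, AEMeasurable (z x) μ)
    (hw0 : ∀ᶠ x in atTop, ∀ᵐ ω ∂μ, 0 ≤ w x ω)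
    (hz0 : ∀ᶠ x in atTop, ∀ᵐ ω ∂μ, z x ω ∈ Set.Icc (0 : ℝ) 1)
    (hwi : ∀ᶠ x in atTop, Integrable (w x) μ)
    (hmom : ∀ k : ℕ, Tendsto (fun x => ∫ ω, w x ω * z x ω ^ k ∂μ) atTop (nhds (1 / (k + 1))))
    (g : ℝ → ℝ) (hg : Continuous g) :
    Tendsto (fun x => ∫ ω, w x ω * g (z x ω) ∂μ) atTop (nhds (∫ t in (0 : ℝ)..1, g t)) := by
  have hint : ∀ g : ℝ → ℝ, Continuous g →
      ∀ᶠ x in atTop, Integrable (fun ω => w x ω * g (z x ω)) μ := by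
    intro g hg
    obtain ⟨C, hC⟩ := (isCompact_Icc (a := (0:ℝ)) (b := 1)).exists_bound_of_continuousOn hg.continuousOn
    filter_upwards [hz, hz0, hwi] with x h1 h2 h3
    refine h3.mul_bdd (c := C) (hg.measurable.comp_aemeasurable h1).aestronglyMeasurable ?_
    filter_upwards [h2] with ω hω using hC _ hω
  have hpoly : ∀ p : Polynomial ℝ, Tendsto (fun x => ∫ ω, w x ω * p.eval (z x ω) ∂μ) atTop
      (nhds (∫ t in (0 : ℝ)..1, p.eval t)) := by
    intro p
    induction p using Polynomial.induction_on' with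
    | add p q hp hq =>
      have h1 := hp.add hq
      rw [← intervalIntegral.integral_add (p.continuous.intervalIntegrable _ _)
        (q.continuous.intervalIntegrable _ _)] at h1
      simp only [Polynomial.eval_add]
      refine h1.congr' ?_
      filter_upwards [hint _ p.continuous, hint _ q.continuous] with x h2 h3
      rw [← integral_add h2 h3]
      simp only [mul_add]
    | monomial k a =>
      have h1 := (hmom k).const_mul a
      simp only [Polynomial.eval_monomial]
      have e : ∫ t in (0:ℝ)..1, a * t ^ k = a * (1 / (k + 1)) := by
        rw [intervalIntegral.integral_const_mul, integral_pow]; simp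
      rw [e]
      refine h1.congr fun x => ?_
      rw [← integral_const_mul]
      congr 1; ext ω; ring
  have hmass : ∀ᶠ x in atTop, ∫ ω, w x ω ∂μ ≤ 2 := by
    have := hmom 0
    simp only [pow_zero, mul_one, Nat.cast_zero, zero_add, div_one] at this
    exact this.eventually (Iic_mem_nhds (by norm_num))
  rw [Metric.tendsto_nhds]
  intro ε hε
  obtain ⟨p, hp⟩ := exists_polynomial_near_of_continuousOn 0 1 g hg.continuousOn (ε/8) (by positivity)
  have h1 := (Metric.tendsto_nhds.1 (hpoly p)) (ε/4) (by positivity)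
  have h2 : |(∫ t in (0 : ℝ)..1, p.eval t) - ∫ t in (0 : ℝ)..1, g t| ≤ ε/8 := by
    rw [← intervalIntegral.integral_sub (p.continuous.intervalIntegrable _ _)
        (hg.intervalIntegrable _ _)]
    have := intervalIntegral.norm_integral_le_of_norm_le_const (a := (0:ℝ)) (b := 1)
      (f := fun t => p.eval t - g t) (C := ε/8) (fun t ht => by
        rw [Set.uIoc_of_le zero_le_one] at ht
        exact (hp t ⟨ht.1.le, ht.2⟩).le)
    simpa using this
  filter_upwards [h1, hint _ p.continuous, hint _ hg, hmass, hwi, hw0, hz0] with x h3 h4 h5 h6 h7 h8 h9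
  have h10 : |(∫ ω, w x ω * p.eval (z x ω) ∂μ) - ∫ ω, w x ω * g (z x ω) ∂μ| ≤ ε/4 := by
    rw [← integral_sub h4 h5]
    have := norm_integral_le_of_norm_le (f := fun ω => w x ω * p.eval (z x ω) - w x ω * g (z x ω))
      (h7.const_mul (ε/8)) (by
        filter_upwards [h8, h9] with ω h8 h9
        rw [← mul_sub, norm_mul, Real.norm_of_nonneg h8, mul_comm]
        exact mul_le_mul_of_nonneg_right (hp _ h9).le h8)
    rw [integral_const_mul] at this
    rw [Real.norm_eq_abs] at this
    nlinarith
  rw [Real.dist_eq] at h3 ⊢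
  rw [abs_lt] at h3 ⊢
  rw [abs_le] at h10 h2
  constructor <;> linarith [h3.1, h3.2, h10.1, h10.2, h2.1, h2.2]

lemma gw_weier_ind {Ω : Type*} [MeasurableSpace Ω] (μ : Measure Ω)
    (w z : ℝ → Ω → ℝ) (hz : ∀ᶠ x in atTop, AEMeasurable (z x) μ)
    (hw0 : ∀ᶠ x in atTop, ∀ᵐ ω ∂μ, 0 ≤ w x ω)
    (hz0 : ∀ᶠ x in atTop, ∀ᵐ ω ∂μ, z x ω ∈ Set.Icc (0 : ℝ) 1)
    (hwi : ∀ᶠ x in atTop, Integrable (w x) μ)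
    (hmom : ∀ k : ℕ, Tendsto (fun x => ∫ ω, w x ω * z x ω ^ k ∂μ) atTop (nhds (1 / (k + 1))))
    (R : ℝ → ℝ) (hR : Continuous R) (hR0 : ∀ t, 0 ≤ R t) (a b : ℝ) (ha : 0 < a) (hab : a < b)
    (hb : b < 1) :
    Tendsto (fun x => ∫ ω, w x ω * (Set.Ico a b).indicator R (z x ω) ∂μ) atTop
      (nhds (∫ t in a..b, R t)) := by
  have hint : ∀ g : ℝ → ℝ, Measurable g → (∃ C, ∀ t ∈ Set.Icc (0:ℝ) 1, ‖g t‖ ≤ C) →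
      ∀ᶠ x in atTop, Integrable (fun ω => w x ω * g (z x ω)) μ := by
    rintro g hg ⟨C, hC⟩
    filter_upwards [hz, hz0, hwi] with x h1 h2 h3
    refine h3.mul_bdd (c := C) (hg.comp_aemeasurable h1).aestronglyMeasurable ?_
    filter_upwards [h2] with ω hω using hC _ hω
  have hintc : ∀ g : ℝ → ℝ, Continuous g →
      ∀ᶠ x in atTop, Integrable (fun ω => w x ω * g (z x ω)) μ := fun g hg =>
    hint g hg.measurable ((isCompact_Icc).exists_bound_of_continuousOn hg.continuousOn)
  have hinti : ∀ᶠ x in atTop, Integrable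
      (fun ω => w x ω * (Set.Ico a b).indicator R (z x ω)) μ := by
    refine hint _ (hR.measurable.indicator measurableSet_Ico) ?_
    obtain ⟨C, hC⟩ := (isCompact_Icc (a := (0:ℝ)) (b := 1)).exists_bound_of_continuousOn hR.continuousOn
    refine ⟨C, fun t ht => ?_⟩
    exact (norm_indicator_le_norm_self _ _).trans (hC t ht)
  -- trapezoids
  let τ : ℝ → ℝ → ℝ → ℝ → ℝ := fun α β δ t => max 0 (min 1 (min ((t - α)/δ) ((β - t)/δ)))
  have hτc : ∀ α β δ, Continuous (τ α β δ) := by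
    intro α β δ; simp only [τ]; fun_prop
  have hτ0 : ∀ α β δ t, 0 ≤ τ α β δ t := fun α β δ t => le_max_left _ _
  have hτ1 : ∀ α β δ t, τ α β δ t ≤ 1 := fun α β δ t => max_le zero_le_one (min_le_left _ _)
  have hτz : ∀ α β δ t, 0 < δ → t ≤ α ∨ β ≤ t → τ α β δ t = 0 := by
    intro α β δ t hδ h
    simp only [τ]
    apply max_eq_left
    rcases h with h | h
    · exact (min_le_right _ _).trans ((min_le_left _ _).trans
        (div_nonpos_of_nonpos_of_nonneg (by linarith) hδ.le))
    · exact (min_le_right _ _).trans ((min_le_right _ _).trans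
        (div_nonpos_of_nonpos_of_nonneg (by linarith) hδ.le))
  have hτo : ∀ α β δ t, 0 < δ → α + δ ≤ t → t ≤ β - δ → τ α β δ t = 1 := by
    intro α β δ t hδ h1 h2
    simp only [τ]
    have h3 : 1 ≤ (t - α)/δ := by rw [le_div_iff₀ hδ]; linarith
    have h4 : 1 ≤ (β - t)/δ := by rw [le_div_iff₀ hδ]; linarith
    rw [min_eq_left (le_min h3 h4)]
    exact max_eq_right zero_le_one
  have hlimp : Tendsto (fun δ : ℝ => ∫ t in (a - δ)..(b + δ), R t) (nhds 0)
      (nhds (∫ t in a..b, R t)) := by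
    have h1 : Continuous (fun δ : ℝ => (∫ t in (0:ℝ)..(b + δ), R t) - ∫ t in (0:ℝ)..(a - δ), R t) :=
      ((intervalIntegral.continuous_primitive (fun _ _ => hR.intervalIntegrable _ _) 0).comp
        (by fun_prop)).sub ((intervalIntegral.continuous_primitive
          (fun _ _ => hR.intervalIntegrable _ _) 0).comp (by fun_prop))
    have h2 := h1.tendsto 0
    simp only [add_zero, sub_zero] at h2
    rw [intervalIntegral.integral_interval_sub_left (hR.intervalIntegrable _ _)
      (hR.intervalIntegrable _ _)] at h2
    refine h2.congr fun δ => ?_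
    rw [intervalIntegral.integral_interval_sub_left (hR.intervalIntegrable _ _)
      (hR.intervalIntegrable _ _)]
  rw [Metric.tendsto_nhds]
  intro ε hε
  have hlimm : Tendsto (fun δ : ℝ => ∫ t in (a + δ)..(b - δ), R t) (nhds 0)
      (nhds (∫ t in a..b, R t)) := by
    have := hlimp.comp (show Tendsto (fun δ : ℝ => -δ) (nhds 0) (nhds 0) by
      simpa using (continuous_neg (G := ℝ)).tendsto 0)
    simpa [Function.comp_def, sub_eq_add_neg] using this
  have hex : ∀ᶠ δ : ℝ in nhdsWithin 0 (Set.Ioi 0), 0 < δ ∧ δ < a ∧ δ < 1 - b ∧ δ < (b - a)/2 ∧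
      dist (∫ t in (a - δ)..(b + δ), R t) (∫ t in a..b, R t) < ε/2 ∧
      dist (∫ t in (a + δ)..(b - δ), R t) (∫ t in a..b, R t) < ε/2 := by
    have e1 : ∀ c : ℝ, 0 < c → ∀ᶠ δ : ℝ in nhdsWithin 0 (Set.Ioi 0), δ < c := fun c hc =>
      nhdsWithin_le_nhds (Iio_mem_nhds hc)
    have e2 := nhdsWithin_le_nhds (s := Set.Ioi 0) (Metric.tendsto_nhds.1 hlimp (ε/2) (by positivity))
    have e3 := nhdsWithin_le_nhds (s := Set.Ioi 0) (Metric.tendsto_nhds.1 hlimm (ε/2) (by positivity))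
    filter_upwards [self_mem_nhdsWithin, e1 a ha, e1 (1-b) (by linarith), e1 ((b-a)/2) (by linarith),
      e2, e3] with δ h1 h2 h3 h4 h5 h6
    exact ⟨h1, h2, h3, h4, h5, h6⟩
  obtain ⟨δ, hδ, hδa, hδb, hδab, hd1, hd2⟩ := hex.exists
  have hgp : Continuous (fun t => τ (a - δ) (b + δ) δ t * R t) := (hτc _ _ _).mul hR
  have hgm : Continuous (fun t => τ a b δ t * R t) := (hτc _ _ _).mul hR
  have hIp : ∫ t in (0:ℝ)..1, τ (a - δ) (b + δ) δ t * R t ≤ ∫ t in (a - δ)..(b + δ), R t := by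
    rw [intervalIntegral.integral_of_le zero_le_one, intervalIntegral.integral_of_le (by linarith)]
    have : Set.Ioc (a - δ) (b + δ) = Set.Ioc 0 1 ∩ Set.Ioc (a - δ) (b + δ) := by
      rw [Set.inter_eq_right.2]
      exact Set.Ioc_subset_Ioc (by linarith) (by linarith)
    rw [this, ← setIntegral_indicator measurableSet_Ioc]
    refine setIntegral_mono hgp.integrableOn_Ioc
      (hR.integrableOn_Ioc.indicator measurableSet_Ioc) (fun t => ?_)
    by_cases ht : t ∈ Set.Ioc (a - δ) (b + δ)
    · simp only [Set.indicator_of_mem ht]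
      exact mul_le_of_le_one_left (hR0 t) (hτ1 _ _ _ _)
    · simp only [Set.indicator_of_notMem ht]
      rw [hτz _ _ _ _ hδ, zero_mul]
      rw [Set.mem_Ioc, not_and_or, not_lt, not_le] at ht
      exact ht.imp id le_of_lt
  have hIm : ∫ t in (a + δ)..(b - δ), R t ≤ ∫ t in (0:ℝ)..1, τ a b δ t * R t := by
    rw [intervalIntegral.integral_of_le zero_le_one, intervalIntegral.integral_of_le (by linarith)]
    have : Set.Ioc (a + δ) (b - δ) = Set.Ioc 0 1 ∩ Set.Ioc (a + δ) (b - δ) := by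
      rw [Set.inter_eq_right.2]
      exact Set.Ioc_subset_Ioc (by linarith) (by linarith)
    rw [this, ← setIntegral_indicator measurableSet_Ioc]
    refine setIntegral_mono (hR.integrableOn_Ioc.indicator measurableSet_Ioc)
      hgm.integrableOn_Ioc (fun t => ?_)
    by_cases ht : t ∈ Set.Ioc (a + δ) (b - δ)
    · simp only [Set.indicator_of_mem ht]
      rw [hτo _ _ _ _ hδ ht.1.le ht.2, one_mul]
    · simp only [Set.indicator_of_notMem ht]
      exact mul_nonneg (hτ0 _ _ _ _) (hR0 t)
  have hWp := Metric.tendsto_nhds.1 (gw_weier μ w z hz hw0 hz0 hwi hmom _ hgp) (ε/2) (by positivity)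
  have hWm := Metric.tendsto_nhds.1 (gw_weier μ w z hz hw0 hz0 hwi hmom _ hgm) (ε/2) (by positivity)
  filter_upwards [hWp, hWm, hinti, hintc _ hgp, hintc _ hgm, hw0] with x h1 h2 h3 h4 h5 h6
  have hA : ∫ ω, w x ω * (Set.Ico a b).indicator R (z x ω) ∂μ
      ≤ ∫ ω, w x ω * (τ (a - δ) (b + δ) δ (z x ω) * R (z x ω)) ∂μ := by
    refine integral_mono_ae h3 h4 ?_
    filter_upwards [h6] with ω h6
    refine mul_le_mul_of_nonneg_left ?_ h6
    by_cases ht : z x ω ∈ Set.Ico a b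
    · rw [Set.indicator_of_mem ht, hτo _ _ _ _ hδ (by linarith [ht.1]) (by linarith [ht.2]), one_mul]
    · rw [Set.indicator_of_notMem ht]
      exact mul_nonneg (hτ0 _ _ _ _) (hR0 _)
  have hB : ∫ ω, w x ω * (τ a b δ (z x ω) * R (z x ω)) ∂μ
      ≤ ∫ ω, w x ω * (Set.Ico a b).indicator R (z x ω) ∂μ := by
    refine integral_mono_ae h5 h3 ?_
    filter_upwards [h6] with ω h6
    refine mul_le_mul_of_nonneg_left ?_ h6
    by_cases ht : z x ω ∈ Set.Ico a b
    · rw [Set.indicator_of_mem ht]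
      exact mul_le_of_le_one_left (hR0 _) (hτ1 _ _ _ _)
    · rw [Set.indicator_of_notMem ht, hτz _ _ _ _ hδ, zero_mul]
      rw [Set.mem_Ico, not_and_or, not_lt, not_le] at ht
      exact ht.imp le_of_lt id
  rw [Real.dist_eq, abs_lt] at *
  constructor <;> linarith [h1.1, h1.2, h2.1, h2.2, hd1.1, hd1.2, hd2.1, hd2.2]

lemma gw_taub {Ω : Type*} [MeasurableSpace Ω] (μ : Measure Ω) [IsProbabilityMeasure μ]
    (X : Ω → ℝ) (hX : AEMeasurable X μ) (hX0 : ∀ᵐ ω ∂μ, 0 ≤ X ω)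
    (S : ℝ → ℝ) (hSpos : ∀ᶠ x in atTop, 0 < S x)
    (hRV : ∀ lam > (0 : ℝ), Tendsto (fun x => S (lam * x) / S x) atTop (nhds lam⁻¹))
    (hM : Tendsto (fun x => (∫ ω, (X ω / x) ^ 2 * Real.exp (-(X ω / x)) ∂μ) / S x) atTop (nhds 1)) :
    Tendsto (fun x => (μ {ω | x < X ω}).toReal / S x) atTop (nhds 1) := by
  let w : ℝ → Ω → ℝ := fun x ω => (X ω / x) ^ 2 * Real.exp (-(X ω / x)) / S x
  let z : ℝ → Ω → ℝ := fun x ω => Real.exp (-(X ω / x))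
  have hz : ∀ᶠ x in atTop, AEMeasurable (z x) μ :=
    Eventually.of_forall fun x => Real.measurable_exp.comp_aemeasurable (hX.div_const x).neg
  have hw0 : ∀ᶠ x in atTop, ∀ᵐ ω ∂μ, 0 ≤ w x ω := by
    filter_upwards [hSpos] with x hx
    exact Eventually.of_forall fun ω => by positivity
  have hz0 : ∀ᶠ x in atTop, ∀ᵐ ω ∂μ, z x ω ∈ Set.Icc (0 : ℝ) 1 := by
    filter_upwards [eventually_gt_atTop 0] with x hx
    filter_upwards [hX0] with ω hω
    refine ⟨(Real.exp_pos _).le, Real.exp_le_one_iff.2 ?_⟩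
    have : 0 ≤ X ω / x := by positivity
    linarith
  have hwi : ∀ᶠ x in atTop, Integrable (w x) μ := by
    filter_upwards [eventually_gt_atTop 0] with x hx
    refine Integrable.div_const ?_ _
    refine Integrable.of_bound (C := 2) ?_ ?_
    · exact (((hX.div_const x).pow_const 2).mul
        (Real.measurable_exp.comp_aemeasurable (hX.div_const x).neg)).aestronglyMeasurable
    · filter_upwards [hX0] with ω hω
      have h0 : 0 ≤ X ω / x := by positivity
      have h1 := Real.quadratic_le_exp_of_nonneg h0
      rw [Real.norm_of_nonneg (by positivity), Real.exp_neg, ← div_eq_mul_inv,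
        div_le_iff₀ (Real.exp_pos _)]
      nlinarith
  have hmom : ∀ k : ℕ, Tendsto (fun x => ∫ ω, w x ω * z x ω ^ k ∂μ) atTop (nhds (1 / (k + 1))) := by
    intro k
    have hk : (0:ℝ) < ((k:ℝ) + 1)⁻¹ := by positivity
    have h1 := hM.comp (tendsto_id.const_mul_atTop hk)
    have h2 := (h1.mul (hRV _ hk)).const_mul ((((k:ℝ) + 1)⁻¹)^2)
    have e : (((k:ℝ) + 1)⁻¹)^2 * (1 * (((k:ℝ) + 1)⁻¹)⁻¹) = 1 / (k + 1) := by
      field_simp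
    rw [e] at h2
    refine h2.congr' ?_
    filter_upwards [hSpos, (tendsto_id.const_mul_atTop hk).eventually hSpos,
      eventually_gt_atTop 0] with x hx hx' hx0
    simp only [Function.comp, id] at hx' ⊢
    have e2 : ∀ ω, w x ω * z x ω ^ k = ((((k:ℝ) + 1)⁻¹)^2 / S x) *
        ((X ω / (((k:ℝ) + 1)⁻¹ * x)) ^ 2 * Real.exp (-(X ω / (((k:ℝ) + 1)⁻¹ * x)))) := by
      intro ω
      simp only [w, z]
      rw [← Real.exp_nat_mul]
      have : Real.exp (-(X ω / (((k:ℝ) + 1)⁻¹ * x))) =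
        Real.exp (-(X ω / x)) * Real.exp (k * (-(X ω / x))) := by
        rw [← Real.exp_add]; congr 1; field_simp; ring
      rw [this]
      field_simp
    simp only [e2]
    rw [integral_const_mul]
    have hne := hx'.ne'
    generalize S (((k:ℝ) + 1)⁻¹ * x) = q at *
    generalize (∫ ω, (X ω / (((k:ℝ) + 1)⁻¹ * x)) ^ 2 *
      Real.exp (-(X ω / (((k:ℝ) + 1)⁻¹ * x))) ∂μ) = q2 at *
    field_simp
  -- the window
  let c : ℝ → ℝ := fun t => max (Real.exp (-3)) (min t (Real.exp (-(1/2))))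
  have hc0 : ∀ t, Real.exp (-3) ≤ c t := fun t => le_max_left _ _
  have hc1 : ∀ t, c t ≤ Real.exp (-(1/2)) := fun t =>
    max_le (Real.exp_le_exp.2 (by norm_num)) (min_le_right _ _)
  have hcpos : ∀ t, 0 < c t := fun t => (Real.exp_pos _).trans_le (hc0 t)
  have hclog : ∀ t, Real.log (c t) < 0 := fun t =>
    Real.log_neg (hcpos t) ((hc1 t).trans_lt (Real.exp_lt_one_iff.2 (by norm_num)))
  have hcc : Continuous c := by simp only [c]; fun_prop
  have hcid : ∀ t, Real.exp (-2) ≤ t → t ≤ Real.exp (-1) → c t = t := by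
    intro t h1 h2
    simp only [c]
    rw [min_eq_left (h2.trans (Real.exp_le_exp.2 (by norm_num))), max_eq_right]
    exact le_trans (Real.exp_le_exp.2 (by norm_num)) h1
  let R : ℝ → ℝ := fun t => 1 / (c t * Real.log (c t) ^ 2)
  have hR : Continuous R := by
    refine continuous_const.div (hcc.mul ((hcc.log fun t => (hcpos t).ne').pow 2)) fun t => ?_
    exact mul_ne_zero (hcpos t).ne' (pow_ne_zero _ (hclog t).ne)
  have hR0 : ∀ t, 0 ≤ R t := fun t => by
    have := hcpos t
    simp only [R]; positivity
  have hRint : ∫ t in Real.exp (-2)..Real.exp (-1), R t = 1/2 := by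
    have hle : Real.exp (-2) ≤ Real.exp (-1) := Real.exp_le_exp.2 (by norm_num)
    have h1 : ∀ t ∈ Set.uIcc (Real.exp (-2)) (Real.exp (-1)),
        HasDerivAt (fun t => - (Real.log t)⁻¹) (R t) t := by
      intro t ht
      rw [Set.uIcc_of_le hle] at ht
      have hid := hcid t ht.1 ht.2
      have h2 := hcpos t
      have h3 := hclog t
      rw [hid] at h2 h3
      have := ((Real.hasDerivAt_log h2.ne').fun_inv h3.ne).neg
      refine this.congr_deriv ?_
      simp only [R, hid]
      have := h3.ne
      field_simp
    rw [intervalIntegral.integral_eq_sub_of_hasDerivAt h1 (hR.intervalIntegrable _ _)]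
    rw [Real.log_exp, Real.log_exp]; norm_num
  have hwin0 := gw_weier_ind μ w z hz hw0 hz0 hwi hmom R hR hR0 (Real.exp (-2)) (Real.exp (-1))
    (Real.exp_pos _) (Real.exp_lt_exp.2 (by norm_num)) (Real.exp_lt_one_iff.2 (by norm_num))
  rw [hRint] at hwin0
  let t : ℝ → ℝ := fun x => (μ {ω | x < X ω}).toReal
  have hnm : ∀ x, NullMeasurableSet {ω | x < X ω} μ := fun x =>
    nullMeasurableSet_lt aemeasurable_const hX
  have hwin : Tendsto (fun x => (t x - t (2 * x)) / S x) atTop (nhds (1/2)) := by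
    refine hwin0.congr' ?_
    filter_upwards [eventually_gt_atTop 0] with x hx
    have hset : t x - t (2 * x) = μ.real ({ω | x < X ω} \ {ω | 2 * x < X ω}) := by
      have h1 : {ω | 2 * x < X ω} ⊆ {ω | x < X ω} := fun ω (h : 2 * x < X ω) => by
        change x < X ω; linarith
      rw [Measure.real, measure_sdiff h1 (hnm _) (measure_ne_top _ _),
        ENNReal.toReal_sub_of_le (measure_mono h1) (measure_ne_top _ _)]
    have hind : μ.real ({ω | x < X ω} \ {ω | 2 * x < X ω}) =
        ∫ ω, ({ω | x < X ω} \ {ω | 2 * x < X ω}).indicator 1 ω ∂μ := by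
      rw [integral_indicator₀ ((hnm x).diff (hnm (2 * x)))]
      simp
    rw [hset, hind, ← integral_div]
    refine integral_congr_ae ?_
    filter_upwards with ω
    by_cases h : x < X ω ∧ X ω ≤ 2 * x
    · have hy1 : 1 < X ω / x := by rw [lt_div_iff₀ hx]; linarith
      have hy2 : X ω / x ≤ 2 := by rw [div_le_iff₀ hx]; linarith
      have hmem : z x ω ∈ Set.Ico (Real.exp (-2)) (Real.exp (-1)) :=
        ⟨Real.exp_le_exp.2 (by linarith), Real.exp_lt_exp.2 (by linarith)⟩
      have hm2 : ω ∈ {ω | x < X ω} \ {ω | 2 * x < X ω} := ⟨h.1, not_lt.2 h.2⟩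
      rw [Set.indicator_of_mem hmem, Set.indicator_of_mem hm2]
      simp only [R, hcid _ hmem.1 hmem.2.le]
      simp only [w, z, Real.log_exp, Pi.one_apply]
      have : X ω / x ≠ 0 := by linarith
      have h3 := Real.exp_ne_zero (-(X ω / x))
      generalize Real.exp (-(X ω / x)) = e at *
      generalize X ω / x = y at *
      field_simp
    · have hm2 : ω ∉ {ω | x < X ω} \ {ω | 2 * x < X ω} := fun h' => h ⟨h'.1, not_lt.1 h'.2⟩
      have hmem : z x ω ∉ Set.Ico (Real.exp (-2)) (Real.exp (-1)) := by
        intro h'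
        apply h
        have h1 := Real.exp_le_exp.1 h'.1
        have h2 := Real.exp_lt_exp.1 h'.2
        constructor
        · have : 1 < X ω / x := by linarith
          rwa [lt_div_iff₀ hx, one_mul] at this
        · have : X ω / x ≤ 2 := by linarith
          rwa [div_le_iff₀ hx] at this
      rw [Set.indicator_of_notMem hmem, Set.indicator_of_notMem hm2]; simp
  -- t tends to zero
  have htlim : Tendsto t atTop (nhds 0) := by
    have h1 : ∀ x, t x = 1 - cdf (μ.map X) x := by
      intro x
      have : IsProbabilityMeasure (μ.map X) := Measure.isProbabilityMeasure_map hX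
      rw [cdf_eq_real]
      have h2 : Set.Iic x = (Set.Ioi x)ᶜ := by simp
      rw [h2, probReal_compl_eq_one_sub measurableSet_Ioi]
      rw [map_measureReal_apply_of_aemeasurable hX measurableSet_Ioi]
      simp only [sub_sub_cancel]; rfl
    have h2 := (tendsto_cdf_atTop (μ.map X)).const_sub 1
    simp only [sub_self] at h2
    exact h2.congr fun x => (h1 x).symm
  have hS2 := hRV 2 (by norm_num)
  have hdiff : Tendsto (fun x => (S x - S (2 * x)) / S x) atTop (nhds (1/2)) := by
    have := hS2.const_sub 1
    rw [show (1:ℝ) - 2⁻¹ = 1/2 by norm_num] at this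
    refine this.congr' ?_
    filter_upwards [hSpos] with x hx
    field_simp
  have hpow : ∀ x > (0:ℝ), Tendsto (fun n : ℕ => 2 ^ n * x) atTop atTop := fun x hx =>
    (tendsto_pow_atTop_atTop_of_one_lt (by norm_num : (1:ℝ) < 2)).atTop_mul_const hx
  rw [Metric.tendsto_nhds]
  intro ε hε
  have hup : ∀ᶠ x in atTop, t x - t (2 * x) ≤ (1 + ε/2) * (S x - S (2 * x)) := by
    have h1 := hwin.sub (hdiff.const_mul (1 + ε/2))
    have h2 := h1.eventually (Iio_mem_nhds (show (1/2:ℝ) - (1 + ε/2) * (1/2) < 0 by linarith))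
    filter_upwards [h2, hSpos] with x hx hs
    rw [mul_div_assoc', ← sub_div, div_lt_iff₀ hs] at hx
    linarith
  have hlo : ∀ᶠ x in atTop, (1 - ε/2) * (S x - S (2 * x)) ≤ t x - t (2 * x) := by
    have h1 := hwin.sub (hdiff.const_mul (1 - ε/2))
    have h2 := h1.eventually (Ioi_mem_nhds (show 0 < (1/2:ℝ) - (1 - ε/2) * (1/2) by linarith))
    filter_upwards [h2, hSpos] with x hx hs
    rw [mul_div_assoc', ← sub_div, lt_div_iff₀ hs] at hx
    linarith
  have hS34 : ∀ᶠ x in atTop, S (2 * x) ≤ 3/4 * S x := by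
    have h2 := hS2.eventually (Iic_mem_nhds (show (2:ℝ)⁻¹ < 3/4 by norm_num))
    filter_upwards [h2, hSpos] with x hx hs
    rwa [div_le_iff₀ hs] at hx
  obtain ⟨X0, hX0'⟩ := eventually_atTop.1 (hup.and (hlo.and (hS34.and hSpos)))
  filter_upwards [eventually_ge_atTop (max X0 1)] with x hx
  have hx0 : 0 < x := lt_of_lt_of_le one_pos ((le_max_right _ _).trans hx)
  have hxn : ∀ n : ℕ, X0 ≤ 2 ^ n * x := fun n => by
    have h1 : (1:ℝ) ≤ 2 ^ n := one_le_pow₀ (by norm_num)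
    have h2 : x ≤ 2 ^ n * x := le_mul_of_one_le_left hx0.le h1
    exact (le_max_left _ _).trans (hx.trans h2)
  have hSx : 0 < S x := by simpa using (hX0' _ (hxn 0)).2.2.2
  have hSn : ∀ n : ℕ, S (2 ^ n * x) ≤ (3/4) ^ n * S x := by
    intro n
    induction n with
    | zero => simp
    | succ n ih =>
      have := (hX0' _ (hxn n)).2.2.1
      rw [show (2:ℝ) ^ (n + 1) * x = 2 * (2 ^ n * x) by ring]
      calc _ ≤ _ := this
        _ ≤ 3/4 * ((3/4) ^ n * S x) := by gcongr
        _ = _ := by ring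
  have hSlim : Tendsto (fun n : ℕ => S (2 ^ n * x)) atTop (nhds 0) := by
    have h1 : Tendsto (fun n : ℕ => (3/4:ℝ) ^ n * S x) atTop (nhds 0) := by
      simpa using (tendsto_pow_atTop_nhds_zero_of_lt_one (by norm_num : (0:ℝ) ≤ 3/4)
        (by norm_num)).mul_const (S x)
    exact squeeze_zero (fun n => (hX0' _ (hxn n)).2.2.2.le) hSn h1
  have hU : ∀ n : ℕ, t x - (1 + ε/2) * S x ≤ t (2 ^ n * x) - (1 + ε/2) * S (2 ^ n * x) := by
    intro n
    induction n with
    | zero => simp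
    | succ n ih =>
      have := (hX0' _ (hxn n)).1
      rw [show (2:ℝ) ^ (n + 1) * x = 2 * (2 ^ n * x) by ring]
      linarith
  have hL : ∀ n : ℕ, t (2 ^ n * x) - (1 - ε/2) * S (2 ^ n * x) ≤ t x - (1 - ε/2) * S x := by
    intro n
    induction n with
    | zero => simp
    | succ n ih =>
      have := (hX0' _ (hxn n)).2.1
      rw [show (2:ℝ) ^ (n + 1) * x = 2 * (2 ^ n * x) by ring]
      linarith
  have ht' := htlim.comp (hpow x hx0)
  have hU2 : t x - (1 + ε/2) * S x ≤ 0 := by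
    have h := ht'.sub (hSlim.const_mul (1 + ε/2))
    rw [mul_zero, sub_zero] at h
    exact ge_of_tendsto' h hU
  have hL2 : 0 ≤ t x - (1 - ε/2) * S x := by
    have h := ht'.sub (hSlim.const_mul (1 - ε/2))
    rw [mul_zero, sub_zero] at h
    exact le_of_tendsto' h hL
  change dist (t x / S x) 1 < ε
  rw [Real.dist_eq, show t x / S x - 1 = (t x - S x) / S x by field_simp, abs_lt]
  constructor
  · rw [lt_div_iff₀ hSx]; nlinarith
  · rw [div_lt_iff₀ hSx]; nlinarith

lemma gw_potter (F : ℝ → ℝ) (hanti : Antitone F) (hpos : ∀ x, 0 < F x) (hle : ∀ x, F x ≤ 1)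
    (hRV : ∀ lam > (0 : ℝ), Tendsto (fun x => F (lam * x) / F x) atTop (nhds lam⁻¹)) :
    ∃ C X0 : ℝ, 0 < C ∧ 0 < X0 ∧ ∀ x ≥ X0, ∀ z, 0 < z → z ≤ x →
      z ^ (3/2 : ℝ) * F z ≤ C * (x ^ (3/2 : ℝ) * F x) := by
  have h1 := (hRV (1/2) (by norm_num)).eventually (Iic_mem_nhds
    (show ((1/2:ℝ))⁻¹ < 2 ^ (3/2:ℝ) by
      rw [one_div, inv_inv]
      nth_rewrite 1 [← Real.rpow_one 2]
      exact Real.rpow_lt_rpow_of_exponent_lt (by norm_num) (by norm_num)))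
  obtain ⟨X1, hX1⟩ := eventually_atTop.1 h1
  set X0 := max X1 1 with hX0
  have hX0pos : 0 < X0 := lt_of_lt_of_le one_pos (le_max_right _ _)
  have hstep : ∀ w ≥ X0 / 2, w ^ (3/2 : ℝ) * F w ≤ (2 * w) ^ (3/2:ℝ) * F (2 * w) := by
    intro w hw
    have hw0 : 0 < w := lt_of_lt_of_le (by positivity) hw
    have h2 := hX1 (2 * w) (by have := le_max_left X1 1; linarith)
    rw [show 1/2 * (2 * w) = w by ring, div_le_iff₀ (hpos _)] at h2
    rw [Real.mul_rpow (by norm_num) hw0.le]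
    have : 0 ≤ w ^ (3/2:ℝ) := by positivity
    nlinarith
  have hpow : ∀ k : ℕ, ∀ w ≥ X0 / 2, w ^ (3/2 : ℝ) * F w ≤ (2 ^ k * w) ^ (3/2:ℝ) * F (2 ^ k * w) := by
    intro k
    induction k with
    | zero => intro w hw; simp
    | succ k ih =>
      intro w hw
      have h2 : w ≤ 2 ^ k * w := le_mul_of_one_le_left
        (le_trans (by positivity) hw) (one_le_pow₀ (by norm_num))
      have := hstep (2 ^ k * w) (le_trans hw h2)
      rw [show (2:ℝ) ^ (k + 1) * w = 2 * (2 ^ k * w) by ring]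
      exact (ih w hw).trans this
  have hbig : ∀ z ≥ X0 / 2, ∀ x ≥ z, z ^ (3/2 : ℝ) * F z ≤ 2 ^ (3/2:ℝ) * (x ^ (3/2 : ℝ) * F x) := by
    intro z hz x hx
    have hz0 : 0 < z := lt_of_lt_of_le (by positivity) hz
    obtain ⟨k, hk1, hk2⟩ := exists_nat_pow_near (x := x / z) (y := 2)
      (by rw [le_div_iff₀ hz0]; linarith) (by norm_num)
    rw [le_div_iff₀ hz0] at hk1
    rw [div_lt_iff₀ hz0] at hk2
    have hx0 : 0 < x := lt_of_lt_of_le hz0 hx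
    calc z ^ (3/2 : ℝ) * F z ≤ (2 ^ (k+1) * z) ^ (3/2:ℝ) * F (2 ^ (k+1) * z) := hpow _ z hz
      _ ≤ (2 * x) ^ (3/2:ℝ) * F x := by
          apply mul_le_mul
          · apply Real.rpow_le_rpow (by positivity) _ (by norm_num)
            calc (2:ℝ) ^ (k + 1) * z = 2 * (2 ^ k * z) := by ring
              _ ≤ _ := by linarith
          · exact hanti hk2.le
          · exact (hpos _).le
          · positivity
      _ = _ := by rw [Real.mul_rpow (by norm_num) hx0.le]; ring
  refine ⟨2 ^ (3/2:ℝ) / F (X0/2), X0, div_pos (by positivity) (hpos _), hX0pos, ?_⟩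
  intro x hx z hz hzx
  have hF := hpos (X0/2)
  have hQ : 0 ≤ 2 ^ (3/2:ℝ) * (x ^ (3/2 : ℝ) * F x) := by
    have := hpos x; have : 0 < x := lt_of_lt_of_le hX0pos hx; positivity
  rw [div_mul_eq_mul_div, le_div_iff₀ hF]
  rcases le_total (X0/2) z with h | h
  · calc _ ≤ z ^ (3/2 : ℝ) * F z * 1 := by
          apply mul_le_mul_of_nonneg_left (hle _)
          have := hpos z; positivity
      _ ≤ _ := by rw [mul_one]; exact hbig z h x hzx
  · have h2 := hbig (X0/2) le_rfl x (by linarith)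
    refine le_trans ?_ h2
    apply mul_le_mul_of_nonneg_right _ hF.le
    calc z ^ (3/2 : ℝ) * F z ≤ z ^ (3/2 : ℝ) * 1 := by
          apply mul_le_mul_of_nonneg_left (hle _) (by positivity)
      _ ≤ (X0/2) ^ (3/2:ℝ) := by
          rw [mul_one]
          exact Real.rpow_le_rpow hz.le h (by norm_num)

lemma gw_abel {Ω : Type*} [MeasurableSpace Ω] (μ : Measure Ω) [IsProbabilityMeasure μ]
    (Y : Ω → ℝ) (hY : Measurable Y) (hY0 : ∀ ω, 0 ≤ Y ω) (F : ℝ → ℝ)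
    (hF : ∀ x, F x = (μ {ω | x < Y ω}).toReal) (hpos : ∀ x, 0 < F x)
    (hRV : ∀ lam > (0 : ℝ), Tendsto (fun x => F (lam * x) / F x) atTop (nhds lam⁻¹))
    (θ : ℝ → ℝ) (hθ : Tendsto θ atTop (nhds 1)) :
    Tendsto (fun x => (∫ ω, (Y ω / x) ^ 2 * Real.exp (-(θ x * (Y ω / x))) ∂μ) / F x) atTop (nhds 1) := by
  have hanti : Antitone F := by
    intro x y hxy
    rw [hF, hF]
    exact ENNReal.toReal_mono (measure_ne_top _ _) (measure_mono fun ω (h : y < Y ω) => lt_of_le_of_lt hxy h)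
  have hle : ∀ x, F x ≤ 1 := fun x => by
    rw [hF]; exact prob_le_one.trans' le_rfl |> ENNReal.toReal_mono (by simp) |>.trans (by simp)
  obtain ⟨C, X0, hC, hX0, hpot⟩ := gw_potter F hanti hpos hle hRV
  have hθ' : ∀ᶠ x in atTop, 1/2 ≤ θ x ∧ θ x ≤ 2 :=
    (hθ.eventually (Ici_mem_nhds (by norm_num))).and (hθ.eventually (Iic_mem_nhds (by norm_num)))
  let G' : ℝ → ℝ → ℝ := fun θ y => (2 * y - θ * y ^ 2) * Real.exp (-(θ * y))
  have hG'c : ∀ θ, Continuous (G' θ) := fun θ => by simp only [G']; fun_prop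
  have hbase : ∀ s : ℝ, -1 < s → IntegrableOn (fun y : ℝ => y ^ s * Real.exp (-(1/2) * y)) (Set.Ioi 0) := by
    intro s hs
    have := integrableOn_rpow_mul_exp_neg_mul_rpow (p := 1) (s := s) (b := 1/2) hs one_pos (by norm_num)
    simpa using this
  have hG'b : ∀ θ, 1/2 ≤ θ → θ ≤ 2 → ∀ y > 0, |G' θ y| ≤ (2 * y + 2 * y ^ 2) * Real.exp (-(1/2) * y) := by
    intro θ h1 h2 y hy
    simp only [G']
    rw [abs_mul, abs_of_pos (Real.exp_pos _)]
    apply mul_le_mul _ (Real.exp_le_exp.2 (by nlinarith)) (Real.exp_pos _).le (by positivity)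
    rw [abs_le]; constructor <;> nlinarith [sq_nonneg y]
  have hG'i : ∀ θ, 1/2 ≤ θ → θ ≤ 2 → IntegrableOn (G' θ) (Set.Ioi 0) := by
    intro θ h1 h2
    have hb : IntegrableOn (fun y : ℝ => (2 * y + 2 * y ^ 2) * Real.exp (-(1/2) * y)) (Set.Ioi 0) := by
      have := ((hbase 1 (by norm_num)).const_mul 2).add ((hbase 2 (by norm_num)).const_mul 2)
      refine IntegrableOn.congr_fun this (fun y hy => ?_) measurableSet_Ioi
      simp; ring
    refine Integrable.mono' hb (hG'c θ).aestronglyMeasurable ?_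
    filter_upwards [ae_restrict_mem measurableSet_Ioi] with y hy using hG'b θ h1 h2 y hy
  have hfub : ∀ x > 0, ∀ θ, 1/2 ≤ θ → θ ≤ 2 →
      ∫ ω, (Y ω / x) ^ 2 * Real.exp (-(θ * (Y ω / x))) ∂μ = ∫ y in Set.Ioi 0, G' θ y * F (x * y) := by
    intro x hx θ h1 h2
    let f : Ω → ℝ → ℝ := fun ω y => {p : Ω × ℝ | x * p.2 < Y p.1}.indicator (fun p => G' θ p.2) (ω, y)
    have hms : MeasurableSet {p : Ω × ℝ | x * p.2 < Y p.1} :=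
      measurableSet_lt (by fun_prop) (by fun_prop)
    have hfi : Integrable (Function.uncurry f) (μ.prod (volume.restrict (Set.Ioi 0))) := by
      have h3 : Integrable (fun p : Ω × ℝ => G' θ p.2) (μ.prod (volume.restrict (Set.Ioi 0))) :=
        Integrable.comp_snd (hG'i θ h1 h2) μ
      exact h3.indicator hms
    have hsw := integral_integral_swap hfi
    have hin : ∀ ω, ∫ y in Set.Ioi 0, f ω y = (Y ω / x) ^ 2 * Real.exp (-(θ * (Y ω / x))) := by
      intro ω
      have e : ∀ y, f ω y = (Set.Iio (Y ω / x)).indicator (G' θ) y := by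
        intro y
        simp only [f, Set.indicator, Set.mem_ofPred_eq, Set.mem_Iio, lt_div_iff₀ hx, mul_comm x y]
      simp only [e]
      rw [setIntegral_indicator measurableSet_Iio, Set.Ioi_inter_Iio, ← integral_Ioc_eq_integral_Ioo,
        ← intervalIntegral.integral_of_le (div_nonneg (hY0 ω) hx.le)]
      have hd : ∀ y ∈ Set.uIcc 0 (Y ω / x), HasDerivAt (fun y => y ^ 2 * Real.exp (-(θ * y))) (G' θ y) y := by
        intro y _
        have h3 := (hasDerivAt_pow 2 y).mul ((((hasDerivAt_id y).const_mul θ).neg).exp)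
        refine h3.congr_deriv ?_
        simp [G']; ring
      rw [intervalIntegral.integral_eq_sub_of_hasDerivAt hd ((hG'c θ).intervalIntegrable _ _)]
      simp
    have hout : ∀ y, ∫ ω, f ω y ∂μ = G' θ y * F (x * y) := by
      intro y
      have e : ∀ ω, f ω y = {ω | x * y < Y ω}.indicator (fun _ => G' θ y) ω := fun ω => rfl
      simp only [e]
      rw [integral_indicator (measurableSet_lt (by fun_prop) hY), hF]
      simp [Measure.real, mul_comm]
    simp only [hin, hout] at hsw
    exact hsw
  have hlimint : ∫ y in Set.Ioi (0:ℝ), G' 1 y * y⁻¹ = 1 := by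
    have e : ∫ y in Set.Ioi (0:ℝ), G' 1 y * y⁻¹ = ∫ y in Set.Ioi (0:ℝ), 
        (2 * (Real.exp (-y) * y ^ ((1:ℝ) - 1)) - Real.exp (-y) * y ^ ((2:ℝ) - 1)) := by
      refine setIntegral_congr_fun measurableSet_Ioi fun y hy => ?_
      have hy' : (y:ℝ) ≠ 0 := ne_of_gt hy
      simp only [G']
      norm_num
      field_simp
    rw [e, integral_sub ((Real.GammaIntegral_convergent one_pos).const_mul 2)
      (Real.GammaIntegral_convergent two_pos), integral_const_mul, ← Real.Gamma_eq_integral one_pos,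
      ← Real.Gamma_eq_integral two_pos, Real.Gamma_one, Real.Gamma_two]
    norm_num
  have hmain : Tendsto (fun x => ∫ y in Set.Ioi (0:ℝ), G' (θ x) y * (F (x * y) / F x)) atTop
      (nhds (∫ y in Set.Ioi (0:ℝ), G' 1 y * y⁻¹)) := by
    refine tendsto_integral_filter_of_dominated_convergence
      (fun y => (2 * y + 2 * y ^ 2) * Real.exp (-(1/2) * y) * (1 + C * y ^ (-(3/2) : ℝ))) ?_ ?_ ?_ ?_
    · refine Eventually.of_forall fun x => ?_
      have hm : Measurable F := hanti.measurable
      exact ((hG'c _).measurable.mul ((hm.comp (by fun_prop)).div_const _)).aestronglyMeasurable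
    · filter_upwards [hθ', eventually_ge_atTop X0] with x hx1 hx2
      filter_upwards [ae_restrict_mem measurableSet_Ioi] with y hy
      have hy0 : (0:ℝ) < y := hy
      have hx0 : 0 < x := hX0.trans_le hx2
      rw [norm_mul, Real.norm_eq_abs, Real.norm_of_nonneg (div_nonneg (hpos _).le (hpos _).le)]
      refine mul_le_mul (hG'b _ hx1.1 hx1.2 y hy) ?_ (div_nonneg (hpos _).le (hpos _).le) (by positivity)
      rw [div_le_iff₀ (hpos x)]
      have hFx := hpos x
      have hyp : 0 < y ^ (-(3/2) : ℝ) := by positivity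
      rcases le_total y 1 with h | h
      · have h3 := hpot x hx2 (x * y) (by positivity) (mul_le_of_le_one_right hx0.le h)
        rw [Real.mul_rpow hx0.le hy0.le] at h3
        have hxp : 0 < x ^ (3/2:ℝ) := by positivity
        have h4 : y ^ (3/2:ℝ) * F (x * y) ≤ C * F x := by
          refine le_of_mul_le_mul_left ?_ hxp
          calc _ = _ := by ring
            _ ≤ _ := h3
            _ = _ := by ring
        have h5 : F (x * y) ≤ C * y ^ (-(3/2) : ℝ) * F x := by
          rw [Real.rpow_neg hy0.le]
          have hyq : 0 < y ^ (3/2:ℝ) := by positivity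
          rw [← div_eq_mul_inv, div_mul_eq_mul_div, le_div_iff₀ hyq]
          linarith
        nlinarith
      · have h3 : F (x * y) ≤ F x := hanti (le_mul_of_one_le_right hx0.le h)
        have : 0 ≤ C * y ^ (-(3/2) : ℝ) * F x := by positivity
        nlinarith
    · have h4 := (((hbase 1 (by norm_num)).const_mul 2).add ((hbase 2 (by norm_num)).const_mul 2)).add
        (((hbase (-(1/2)) (by norm_num)).const_mul (2*C)).add ((hbase (1/2) (by norm_num)).const_mul (2*C)))
      refine IntegrableOn.congr_fun h4 (fun y hy => ?_) measurableSet_Ioi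
      have hy0 : (0:ℝ) < y := hy
      have e1 : y ^ (-(1/2):ℝ) = y * y ^ (-(3/2) : ℝ) := by
        nth_rewrite 2 [← Real.rpow_one y]
        rw [← Real.rpow_add hy0]; norm_num
      have e2 : y ^ (1/2:ℝ) = y^2 * y ^ (-(3/2) : ℝ) := by
        rw [← Real.rpow_natCast y 2, ← Real.rpow_add hy0]; norm_num
      simp only [Pi.add_apply]
      rw [e1, e2]
      simp
      ring
    · filter_upwards [ae_restrict_mem measurableSet_Ioi] with y hy
      refine Tendsto.mul ?_ ?_
      · have : Continuous (fun θ => G' θ y) := by simp only [G']; fun_prop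
        exact (this.tendsto 1).comp hθ
      · refine (hRV y hy).congr fun x => by rw [mul_comm x y]
  rw [hlimint] at hmain
  refine hmain.congr' ?_
  filter_upwards [hθ', eventually_gt_atTop 0] with x hx1 hx2
  rw [hfub x hx2 _ hx1.1 hx1.2, ← integral_div]
  congr 1; ext y; ring

lemma gw_expset {Ω : Type*} [MeasurableSpace Ω] (μ : Measure Ω) [IsProbabilityMeasure μ]
    (X : Ω → ℝ) (hX : AEMeasurable X μ) (hX0 : ∀ᵐ ω ∂μ, 0 ≤ X ω) (s : ℝ) (hs : 0 < s) :
    -s ∈ interior (integrableExpSet X μ) := by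
  rw [mem_interior]
  refine ⟨Set.Iio 0, fun t ht => ?_, isOpen_Iio, by simpa using hs⟩
  change Integrable (fun ω => Real.exp (t * X ω)) μ
  refine Integrable.of_bound (C := 1)
    (Real.measurable_exp.comp_aemeasurable (hX.const_mul t)).aestronglyMeasurable ?_
  filter_upwards [hX0] with ω hω
  rw [Real.norm_of_nonneg (Real.exp_pos _).le, Real.exp_le_one_iff]
  exact mul_nonpos_of_nonpos_of_nonneg (le_of_lt ht) hω

lemma gw_lap_int {Ω : Type*} [MeasurableSpace Ω] (μ : Measure Ω) [IsProbabilityMeasure μ]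
    (X : Ω → ℝ) (hX : AEMeasurable X μ) (hX0 : ∀ᵐ ω ∂μ, 0 ≤ X ω) (k : ℕ) (s : ℝ) (hs : 0 < s) :
    Integrable (fun ω => X ω ^ k * Real.exp (-(s * X ω))) μ := by
  have := integrable_pow_mul_exp_of_mem_interior_integrableExpSet (gw_expset μ X hX hX0 s hs) k
  simpa only [neg_mul] using this

lemma gw_lap_deriv {Ω : Type*} [MeasurableSpace Ω] (μ : Measure Ω) [IsProbabilityMeasure μ]
    (X : Ω → ℝ) (hX : AEMeasurable X μ) (hX0 : ∀ᵐ ω ∂μ, 0 ≤ X ω) (k : ℕ) (s : ℝ) (hs : 0 < s) :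
    HasDerivAt (fun s => ∫ ω, X ω ^ k * Real.exp (-(s * X ω)) ∂μ)
      (-∫ ω, X ω ^ (k + 1) * Real.exp (-(s * X ω)) ∂μ) s := by
  have h1 := hasDerivAt_integral_pow_mul_exp_real (gw_expset μ X hX hX0 s hs) k
  have h2 := HasDerivAt.comp s h1 (hasDerivAt_neg s)
  simp only [neg_mul, Function.comp_def, mul_neg, mul_one] at h2
  exact h2

lemma gw_lap_pos {Ω : Type*} [MeasurableSpace Ω] (μ : Measure Ω) [IsProbabilityMeasure μ]
    (X : Ω → ℝ) (hX : AEMeasurable X μ) (hX0 : ∀ᵐ ω ∂μ, 0 ≤ X ω) (hm : 0 < ∫ ω, X ω ∂μ)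
    (s : ℝ) (hs : 0 < s) :
    0 < ∫ ω, X ω ^ 1 * Real.exp (-(s * X ω)) ∂μ := by
  have h0 : 0 ≤ᵐ[μ] fun ω => X ω ^ 1 * Real.exp (-(s * X ω)) := by
    filter_upwards [hX0] with ω hω
    simp only [Pi.zero_apply]; positivity
  refine lt_of_le_of_ne (integral_nonneg_of_ae h0) fun h => ?_
  have h2 := (integral_eq_zero_iff_of_nonneg_ae h0 (gw_lap_int μ X hX hX0 1 s hs)).1 h.symm
  have h3 : ∫ ω, X ω ∂μ = 0 := by
    rw [← integral_zero Ω ℝ (μ := μ)]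
    refine integral_congr_ae ?_
    filter_upwards [h2] with ω hω
    simpa using hω
  linarith

lemma gw_lap_lim {Ω : Type*} [MeasurableSpace Ω] (μ : Measure Ω) [IsProbabilityMeasure μ]
    (X : Ω → ℝ) (hX0 : ∀ᵐ ω ∂μ, 0 ≤ X ω) (hXi : Integrable X μ)
    (a : ℝ → ℝ) (ha : Tendsto a atTop (nhds 0)) (ha0 : ∀ᶠ x in atTop, 0 ≤ a x) :
    Tendsto (fun x => ∫ ω, X ω ^ 1 * Real.exp (-(a x * X ω)) ∂μ) atTop (nhds (∫ ω, X ω ∂μ)) := by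
  refine tendsto_integral_filter_of_dominated_convergence X ?_ ?_ hXi ?_
  · exact Eventually.of_forall fun x => ((hXi.aemeasurable.pow_const 1).mul
      (Real.measurable_exp.comp_aemeasurable (hXi.aemeasurable.const_mul _).neg)).aestronglyMeasurable
  · filter_upwards [ha0] with x hx
    filter_upwards [hX0] with ω hω
    rw [Real.norm_of_nonneg (by positivity), pow_one]
    exact mul_le_of_le_one_right hω (Real.exp_le_one_iff.2 (by nlinarith))
  · refine Eventually.of_forall fun ω => ?_
    have : Continuous (fun t : ℝ => X ω ^ 1 * Real.exp (-(t * X ω))) := by fun_prop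
    simpa [Function.comp_def] using (this.tendsto 0).comp ha

lemma gw_core {Ω : Type*} [MeasurableSpace Ω] (μ : Measure Ω) [IsProbabilityMeasure μ]
    (X Y : Ω → ℝ) (hX0 : ∀ᵐ ω ∂μ, 0 ≤ X ω) (hXi : Integrable X μ)
    (hX1 : ∫ ω, X ω ∂μ = 1)
    (hY : Measurable Y) (hY0 : ∀ ω, 0 ≤ Y ω) (hYi : Integrable Y μ) (hYsq : ∀ ω, Y ω ≤ Y ω ^ 2)
    (m : ℝ) (hm : m = ∫ ω, Y ω ∂μ) (hm1 : 1 < m)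
    (hfe : ∀ s > 0, ∫ ω, Real.exp (-(s * X ω)) ∂μ =
      ∫ ω, Real.exp (-(-Real.log (∫ ω, Real.exp (-(s / m * X ω)) ∂μ) * Y ω)) ∂μ)
    (F : ℝ → ℝ)
    (hF : ∀ x, F x = (μ {ω | x < Y ω}).toReal) (hpos : ∀ x, 0 < F x)
    (hRV : ∀ lam > (0 : ℝ), Tendsto (fun x => F (lam * x) / F x) atTop (nhds lam⁻¹)) :
    Tendsto (fun x => (∫ ω, (X ω / x) ^ 2 * Real.exp (-(X ω / x)) ∂μ) /
      ∑' i : ℕ, m ^ i * F (m ^ (i + 1) * x)) atTop (nhds 1) := by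
  have hXm := hXi.aemeasurable
  have hm0 : 0 < m := by linarith
  have hY0' : ∀ᵐ ω ∂μ, 0 ≤ Y ω := Eventually.of_forall hY0
  let e : ℕ → ℝ → ℝ := fun k s => ∫ ω, X ω ^ k * Real.exp (-(s * X ω)) ∂μ
  let L : ℕ → ℝ → ℝ := fun k s => ∫ ω, Y ω ^ k * Real.exp (-(s * Y ω)) ∂μ
  have hed : ∀ k s, 0 < s → HasDerivAt (e k) (-e (k+1) s) s := fun k s hs =>
    gw_lap_deriv μ X hXm hX0 k s hs
  have hLd : ∀ k s, 0 < s → HasDerivAt (L k) (-L (k+1) s) s := fun k s hs =>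
    gw_lap_deriv μ Y hY.aemeasurable hY0' k s hs
  have he1 : ∀ s, 0 < s → 0 < e 1 s := fun s hs => gw_lap_pos μ X hXm hX0 (by rw [hX1]; norm_num) s hs
  have hL1 : ∀ s, 0 < s → 0 < L 1 s := fun s hs =>
    gw_lap_pos μ Y hY.aemeasurable hY0' (by rw [← hm]; linarith) s hs
  have he0' : ∀ s, e 0 s = ∫ ω, Real.exp (-(s * X ω)) ∂μ := fun s => by simp [e]
  have hL0' : ∀ s, L 0 s = ∫ ω, Real.exp (-(s * Y ω)) ∂μ := fun s => by simp [L]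
  have he0 : ∀ s, 0 < s → 0 < e 0 s := by
    intro s hs
    have hi := gw_lap_int μ X hXm hX0 0 s hs
    simp only [e]
    exact integral_pos_iff_support_of_nonneg_ae (Eventually.of_forall fun ω => by
      simp only [Pi.zero_apply]; positivity) hi |>.2 (by
      have : Function.support (fun ω => X ω ^ 0 * Real.exp (-(s * X ω))) = Set.univ := by
        ext ω; simp [(Real.exp_pos _).ne']
      rw [this]; simp)
  have hexp1 : ∀ s, 0 < s → s * e 1 s ≤ 1 - e 0 s := by
    intro s hs
    have hi1 := (gw_lap_int μ X hXm hX0 1 s hs)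
    have hi0 := (gw_lap_int μ X hXm hX0 0 s hs)
    have h1 : 1 - e 0 s = ∫ ω, (1 - X ω ^ 0 * Real.exp (-(s * X ω))) ∂μ := by
      rw [integral_sub (integrable_const _) hi0]; simp [e]
    rw [h1]
    simp only [e]
    rw [← integral_const_mul]
    refine integral_mono_ae (hi1.const_mul s) ((integrable_const _).sub hi0) ?_
    filter_upwards [hX0] with ω hω
    have h2 := Real.add_one_le_exp (s * X ω)
    have h3 := Real.exp_pos (-(s * X ω))
    have h4 : Real.exp (s * X ω) * Real.exp (-(s * X ω)) = 1 := by rw [← Real.exp_add]; simp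
    simp only [pow_one, pow_zero, one_mul]
    nlinarith
  have he0lt : ∀ s, 0 < s → e 0 s < 1 := fun s hs => by
    have := hexp1 s hs; have := he1 s hs; nlinarith
  let κ : ℝ → ℝ := fun s => -Real.log (e 0 s)
  have hκpos : ∀ s, 0 < s → 0 < κ s := fun s hs => neg_pos.2 (Real.log_neg (he0 s hs) (he0lt s hs))
  have hκd : ∀ s, 0 < s → HasDerivAt κ (e 1 s / e 0 s) s := by
    intro s hs
    have := ((hed 0 s hs).log (he0 s hs).ne').neg
    refine this.congr_deriv ?_
    ring
  have hfe0 : ∀ s, 0 < s → e 0 s = L 0 (κ (s / m)) := by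
    intro s hs
    simp only [κ, he0', hL0']
    exact hfe s hs
  have hdiv : ∀ s : ℝ, HasDerivAt (fun s => s / m) (1 / m) s := fun s => (hasDerivAt_id s).div_const m
  have hfe1 : ∀ s, 0 < s → e 1 s = L 1 (κ (s / m)) * (e 1 (s/m) / e 0 (s/m)) / m := by
    intro s hs
    have hσ : 0 < s / m := by positivity
    have h1 := (hLd 0 _ (hκpos _ hσ)).comp s ((hκd _ hσ).comp s (hdiv s))
    have h2 : HasDerivAt (e 0) (-L (0 + 1) (κ (s / m)) * (e 1 (s / m) / e 0 (s / m) * (1 / m))) s := by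
      refine h1.congr_of_eventuallyEq ?_
      filter_upwards [Ioi_mem_nhds hs] with r hr
      exact hfe0 r hr
    have h3 := (hed 0 s hs).unique h2
    simp only [zero_add] at h3
    linear_combination -h3
  have hfe2 : ∀ s, 0 < s → e 2 s = (L 2 (κ (s / m)) * (e 1 (s/m) / e 0 (s/m)) ^ 2 +
      L 1 (κ (s/m)) * (e 2 (s/m) / e 0 (s/m) - (e 1 (s/m) / e 0 (s/m)) ^ 2)) / m ^ 2 := by
    intro s hs
    have hσ : 0 < s / m := by positivity
    have h1 := (hLd 1 _ (hκpos _ hσ)).comp s ((hκd _ hσ).comp s (hdiv s))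
    have hne : (e 0 ∘ fun s => s / m) s ≠ 0 := (he0 _ hσ).ne'
    have h2a : HasDerivAt (e 1 ∘ fun s => s / m) _ s := HasDerivAt.comp s (hed 1 _ hσ) (hdiv s)
    have h2b : HasDerivAt (e 0 ∘ fun s => s / m) _ s := HasDerivAt.comp s (hed 0 _ hσ) (hdiv s)
    have h2 := h2a.div h2b hne
    have h3 := (h1.mul h2).div_const m
    have h4 := h3.congr_of_eventuallyEq (f₁ := e 1) (by
      filter_upwards [Ioi_mem_nhds hs] with r hr
      exact hfe1 r hr)
    have h5 := (hed 1 s hs).unique h4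
    simp only [zero_add, Function.comp, Nat.reduceAdd, Pi.div_apply] at h5
    have h6 := (he0 _ hσ).ne'
    rw [← neg_inj, h5]
    field_simp
    ring
  let p : ℝ → ℝ := fun s => s * e 2 s / e 1 s
  let β : ℝ → ℝ := fun σ => σ * (e 1 σ / e 0 σ) * (L 2 (κ σ) / L 1 (κ σ) - 1)
  have hrec : ∀ σ, 0 < σ → p (m * σ) = p σ + β σ := by
    intro σ hσ
    have hs : 0 < m * σ := by positivity
    have h1 := hfe1 _ hs
    have h2 := hfe2 _ hs
    have e' : m * σ / m = σ := by field_simp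
    rw [e'] at h1 h2
    simp only [p, β]
    rw [h1, h2]
    have h3 := (he0 _ hσ).ne'
    have h4 := (he1 _ hσ).ne'
    have h5 := (hL1 _ (hκpos _ hσ)).ne'
    field_simp
    ring
  have hβ0 : ∀ σ, 0 < σ → 0 ≤ β σ := by
    intro σ hσ
    have h1 : 1 ≤ L 2 (κ σ) / L 1 (κ σ) := by
      rw [one_le_div (hL1 _ (hκpos _ hσ))]
      refine integral_mono (gw_lap_int μ Y hY.aemeasurable hY0' 1 _ (hκpos _ hσ))
        (gw_lap_int μ Y hY.aemeasurable hY0' 2 _ (hκpos _ hσ)) fun ω => ?_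
      have := hYsq ω
      simp only [pow_one]
      gcongr
    have := he0 _ hσ
    have := he1 _ hσ
    simp only [β]
    exact mul_nonneg (by positivity) (by linarith)
  have hinv : Tendsto (fun x : ℝ => 1 / x) atTop (nhds 0) := by
    simpa using tendsto_inv_atTop_zero (𝕜 := ℝ)
  have hinv0 : ∀ᶠ x : ℝ in atTop, 0 ≤ 1 / x := by
    filter_upwards [eventually_gt_atTop 0] with x hx; positivity
  have hle1 : Tendsto (fun x => e 1 (1 / x)) atTop (nhds 1) := by
    have := gw_lap_lim μ X hX0 hXi _ hinv hinv0
    rwa [hX1] at this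
  -- x(1-e0(1/x)) → 1
  have hu : Tendsto (fun x => x * (1 - e 0 (1/x))) atTop (nhds 1) := by
    refine tendsto_of_tendsto_of_tendsto_of_le_of_le' hle1 tendsto_const_nhds ?_ ?_
    · filter_upwards [eventually_gt_atTop 0] with x hx
      have h1 := hexp1 (1/x) (by positivity)
      calc e 1 (1/x) = x * (1/x * e 1 (1/x)) := by field_simp
        _ ≤ _ := by gcongr
    · filter_upwards [eventually_gt_atTop 0] with x hx
      have hs : 0 < 1 / x := by positivity
      have hi0 := (gw_lap_int μ X hXm hX0 0 (1/x) hs)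
      have h1 : 1 - e 0 (1/x) ≤ 1/x := by
        have h1 : 1 - e 0 (1/x) = ∫ ω, (1 - X ω ^ 0 * Real.exp (-(1/x * X ω))) ∂μ := by
          rw [integral_sub (integrable_const _) hi0]; simp [e]
        have h2 : 1/x = ∫ ω, 1/x * X ω ∂μ := by rw [integral_const_mul, hX1, mul_one]
        rw [h1]
        nth_rewrite 2 [h2]
        refine integral_mono ((integrable_const _).sub hi0) (hXi.const_mul _) fun ω => ?_
        have := Real.add_one_le_exp (-(1/x * X ω))
        simp only [pow_zero, one_mul]
        linarith
      calc x * (1 - e 0 (1/x)) ≤ x * (1/x) := by gcongr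
        _ = 1 := by field_simp
  have hle0 : Tendsto (fun x => e 0 (1 / x)) atTop (nhds 1) := by
    have h1 := (hu.mul hinv).const_sub 1
    simp only [mul_zero, sub_zero] at h1
    refine h1.congr' ?_
    filter_upwards [eventually_gt_atTop 0] with x hx
    field_simp
    ring
  have hθ : Tendsto (fun x => x * κ (1/x)) atTop (nhds 1) := by
    have h2 := hu.div hle0 one_ne_zero
    rw [div_one] at h2
    refine tendsto_of_tendsto_of_tendsto_of_le_of_le' hu h2 ?_ ?_
    · filter_upwards [eventually_gt_atTop 0] with x hx
      have := Real.log_le_sub_one_of_pos (he0 (1/x) (by positivity))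
      simp only [κ]
      gcongr
      linarith
    · filter_upwards [eventually_gt_atTop 0] with x hx
      have h3 := he0 (1/x) (by positivity)
      have := Real.one_sub_inv_le_log_of_pos h3
      simp only [κ, Pi.div_apply]
      rw [mul_div_assoc]
      gcongr
      have h4 : (1 - e 0 (1/x)) / e 0 (1/x) = (e 0 (1/x))⁻¹ - 1 := by field_simp
      rw [h4]; linarith
  have hκlim : Tendsto (fun x => κ (1/x)) atTop (nhds 0) := by
    have h1 := hθ.mul hinv
    rw [mul_zero] at h1
    refine h1.congr' ?_
    filter_upwards [eventually_gt_atTop 0] with x hx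
    field_simp
  have hlL1 : Tendsto (fun x => L 1 (κ (1/x))) atTop (nhds m) := by
    have := gw_lap_lim μ Y hY0' hYi _ hκlim (by
      filter_upwards [eventually_gt_atTop 0] with x hx using (hκpos _ (by positivity)).le)
    rwa [← hm] at this
  have hlL2 : Tendsto (fun x => L 2 (κ (1/x)) / (x ^ 2 * F x)) atTop (nhds 1) := by
    refine (gw_abel μ Y hY hY0 F hF hpos hRV _ hθ).congr' ?_
    filter_upwards [eventually_gt_atTop 0] with x hx
    have h1 : ∀ ω, (Y ω / x) ^ 2 * Real.exp (-(x * κ (1 / x) * (Y ω / x))) =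
        (1 / x ^ 2) * (Y ω ^ 2 * Real.exp (-(κ (1/x) * Y ω))) := by
      intro ω
      have : x * κ (1 / x) * (Y ω / x) = κ (1/x) * Y ω := by field_simp
      rw [this]; field_simp
    simp only [h1]
    rw [integral_const_mul]
    simp only [L]
    have := hpos x
    generalize (∫ ω, Y ω ^ 2 * Real.exp (-(κ (1/x) * Y ω)) ∂μ) = q
    field_simp
  have hanti : Antitone F := by
    intro x y hxy
    rw [hF, hF]
    exact ENNReal.toReal_mono (measure_ne_top _ _) (measure_mono fun ω (h : y < Y ω) => lt_of_le_of_lt hxy h)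
  have hle : ∀ x, F x ≤ 1 := fun x => by
    rw [hF]; exact prob_le_one.trans' le_rfl |> ENNReal.toReal_mono (by simp) |>.trans (by simp)
  have hx2F : Tendsto (fun x => 1 / (x ^ 2 * F x)) atTop (nhds 0) := by
    obtain ⟨C, X0, hC, hX0, hpot⟩ := gw_potter F hanti hpos hle hRV
    have hc : 0 < X0 ^ (3/2:ℝ) * F X0 := by have := hpos X0; positivity
    have h1 : Tendsto (fun x : ℝ => C / (X0 ^ (3/2:ℝ) * F X0) * x ^ (-(1/2):ℝ)) atTop (nhds 0) := by
      simpa using (tendsto_rpow_neg_atTop (show (0:ℝ) < 1/2 by norm_num)).const_mul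
        (C / (X0 ^ (3/2:ℝ) * F X0))
    refine tendsto_of_tendsto_of_tendsto_of_le_of_le' tendsto_const_nhds h1 ?_ ?_
    · filter_upwards with x
      have := hpos x; positivity
    · filter_upwards [eventually_ge_atTop X0] with x hx
      have hx0 : 0 < x := hX0.trans_le hx
      have h2 := hpot x hx X0 hX0 hx
      have h3 : x ^ 2 = x ^ (3/2:ℝ) * x ^ (1/2:ℝ) := by
        rw [← Real.rpow_add hx0, ← Real.rpow_natCast]; norm_num
      rw [Real.rpow_neg hx0.le, h3]
      have h4 := hpos x
      have h5 : 0 < x ^ (1/2:ℝ) := by positivity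
      have h6 : 0 < x ^ (3/2:ℝ) := by positivity
      rw [div_mul_eq_mul_div, div_le_div_iff₀ (by positivity) hc, one_mul]
      calc _ ≤ _ := h2
        _ = _ := by field_simp
  have hr : Tendsto (fun y => (m * β (1/y) / y) / F y) atTop (nhds 1) := by
    have h1 := ((hle1.div hle0 one_ne_zero).const_mul m).mul ((hlL2.div hlL1 hm0.ne').sub hx2F)
    have e1 : m * (1 / 1) * (1 / m - 0) = 1 := by field_simp; ring
    rw [e1] at h1
    refine h1.congr' ?_
    filter_upwards [eventually_gt_atTop 0] with x hx
    simp only [β, Pi.div_apply]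
    have := (hpos x).ne'
    have := (hL1 _ (hκpos (1/x) (by positivity))).ne'
    have := (he0 (1/x) (by positivity)).ne'
    field_simp
  have hp0 : Tendsto (fun x => p (1/x)) atTop (nhds 0) := by
    have h1 : Tendsto (fun x : ℝ => ∫ ω, 1/x * (X ω ^ 2 * Real.exp (-(1/x * X ω))) ∂μ) atTop
        (nhds (∫ ω, (0:ℝ) ∂μ)) := by
      refine tendsto_integral_filter_of_dominated_convergence X ?_ ?_ hXi ?_
      · exact Eventually.of_forall fun x => (((hXm.pow_const 2).mul
          (Real.measurable_exp.comp_aemeasurable (hXm.const_mul _).neg)).const_mul _).aestronglyMeasurable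
      · filter_upwards [eventually_gt_atTop 0] with x hx
        filter_upwards [hX0] with ω hω
        rw [Real.norm_of_nonneg (by positivity)]
        have h2 := Real.add_one_le_exp (1/x * X ω)
        have h3 : 1/x * X ω * Real.exp (-(1/x * X ω)) ≤ 1 := by
          rw [Real.exp_neg, ← div_eq_mul_inv, div_le_one (Real.exp_pos _)]; linarith
        calc _ = X ω * (1/x * X ω * Real.exp (-(1/x * X ω))) := by ring
          _ ≤ X ω * 1 := by gcongr
          _ = _ := mul_one _
      · refine Eventually.of_forall fun ω => ?_
        have : Continuous (fun t : ℝ => t * (X ω ^ 2 * Real.exp (-(t * X ω)))) := by fun_prop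
        simpa [Function.comp_def] using (this.tendsto 0).comp hinv
    rw [integral_zero] at h1
    have h2 := h1.div hle1 one_ne_zero
    rw [zero_div] at h2
    refine h2.congr fun x => ?_
    simp only [Pi.div_apply]
    rw [integral_const_mul]
  have hHS : ∀ x > 0, HasSum (fun i : ℕ => β (1 / (m ^ (i+1) * x))) (p (1/x)) := by
    intro x hx
    rw [hasSum_iff_tendsto_nat_of_nonneg (fun i => hβ0 _ (by positivity))]
    have h1 : ∀ n : ℕ, ∑ i ∈ Finset.range n, β (1 / (m ^ (i+1) * x)) =
        p (1/x) - p (1 / (m ^ n * x)) := by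
      intro n
      induction n with
      | zero => simp
      | succ n ih =>
        rw [Finset.sum_range_succ, ih]
        have h2 := hrec (1 / (m ^ (n+1) * x)) (by positivity)
        have h3 : m * (1 / (m ^ (n+1) * x)) = 1 / (m ^ n * x) := by
          rw [pow_succ]; field_simp
        rw [h3] at h2
        linarith
    simp only [h1]
    have h4 : Tendsto (fun n : ℕ => m ^ n * x) atTop atTop :=
      (tendsto_pow_atTop_atTop_of_one_lt hm1).atTop_mul_const hx
    have h5 := (hp0.comp h4).const_sub (p (1/x))
    rw [sub_zero] at h5
    exact h5
  have hfin := (gw_sumlem hm1 (fun y => m * β (1/y) / y) F (fun x => p (1/x) / x)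
    (Eventually.of_forall hpos) hr (by
      filter_upwards [eventually_gt_atTop 0] with x hx
      have := (hHS x hx).div_const x
      refine this.congr_fun fun i => ?_
      rw [pow_succ]; field_simp)).2
  have h7 := hfin.mul hle1
  rw [mul_one] at h7
  refine h7.congr' ?_
  filter_upwards [eventually_gt_atTop 0] with x hx
  have h1 : ∀ ω, (X ω / x) ^ 2 * Real.exp (-(X ω / x)) =
      (1 / x ^ 2) * (X ω ^ 2 * Real.exp (-(1 / x * X ω))) := by
    intro ω
    rw [show 1 / x * X ω = X ω / x by ring]; field_simp
  simp only [h1]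
  rw [integral_const_mul]
  have h8 : ∫ ω, X ω ^ 2 * Real.exp (-(1 / x * X ω)) ∂μ = e 2 (1/x) := rfl
  rw [h8]
  simp only [p]
  have h9 := (he1 (1/x) (by positivity)).ne'
  generalize (∑' i : ℕ, m ^ i * F (m ^ (i + 1) * x)) = q
  generalize e 1 (1/x) = q1 at *
  generalize e 2 (1/x) = q2 at *
  field_simp

lemma gw_Fint {Ω : Type*} [MeasurableSpace Ω] (μ : Measure Ω) [IsProbabilityMeasure μ]
    (Y : Ω → ℝ) (hY0 : ∀ ω, 0 ≤ Y ω) (hYi : Integrable Y μ)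
    (F : ℝ → ℝ) (hF : ∀ x, F x = (μ {ω | x < Y ω}).toReal) (hanti : Antitone F) :
    IntegrableOn F (Set.Ioi 0) := by
  refine ⟨hanti.measurable.aestronglyMeasurable, ?_⟩
  have h1 := lintegral_eq_lintegral_meas_lt μ (Eventually.of_forall hY0) hYi.aemeasurable
  have h2 : ∫⁻ ω, ENNReal.ofReal (Y ω) ∂μ < ⊤ := hYi.lintegral_lt_top
  rw [h1] at h2
  rw [hasFiniteIntegral_iff_enorm]
  refine lt_of_le_of_lt (le_of_eq ?_) h2
  refine lintegral_congr fun t => ?_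
  rw [hF, Real.enorm_of_nonneg ENNReal.toReal_nonneg, ENNReal.ofReal_toReal (measure_ne_top _ _)]

lemma gw_F1 (F : ℝ → ℝ) (hanti : Antitone F) (hpos : ∀ x, 0 < F x)
    (hRV : ∀ lam > (0 : ℝ), Tendsto (fun x => F (lam * x) / F x) atTop (nhds lam⁻¹))
    (m : ℝ) (hm1 : 1 < m) :
    Tendsto (fun y => (1 / (y * Real.log m) * ∫ u in (y / m)..y, F u) / F y) atTop (nhds 1) := by
  have hm0 : 0 < m := by linarith
  have hlog := Real.log_pos hm1
  have hle : 1 / m ≤ 1 := by rw [div_le_one hm0]; exact hm1.le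
  have h1 : Tendsto (fun y => ∫ t in (1/m)..1, F (t * y) / F y) atTop
      (nhds (∫ t in (1/m)..1, t⁻¹)) := by
    refine intervalIntegral.tendsto_integral_filter_of_dominated_convergence (fun _ => m + 1) ?_ ?_ ?_ ?_
    · filter_upwards [eventually_gt_atTop 0] with y hy
      have h2 : Antitone (fun t => F (t * y)) := fun a b hab => hanti (by gcongr)
      exact (h2.measurable.div_const _).aestronglyMeasurable
    · have h2 := hRV (1/m) (by positivity)
      rw [one_div, inv_inv] at h2
      filter_upwards [h2.eventually (Iio_mem_nhds (lt_add_one m)), eventually_gt_atTop 0] with y hy hy0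
      refine Eventually.of_forall fun t ht => ?_
      rw [Set.uIoc_of_le hle] at ht
      have h3 := hpos (t * y)
      have h4 := hpos y
      rw [Real.norm_of_nonneg (by positivity)]
      refine le_trans ?_ (le_of_lt hy)
      gcongr
      apply hanti
      rw [← one_div]
      gcongr
      exact ht.1.le
    · exact intervalIntegrable_const
    · refine Eventually.of_forall fun t ht => ?_
      rw [Set.uIoc_of_le hle] at ht
      exact hRV t (lt_trans (by positivity) ht.1)
  rw [integral_inv_of_pos (by positivity) (by norm_num)] at h1
  have e1 : (1:ℝ) / (1 / m) = m := by field_simp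
  rw [e1] at h1
  have h5 := h1.div_const (Real.log m)
  rw [div_self hlog.ne'] at h5
  refine h5.congr' ?_
  filter_upwards [eventually_gt_atTop 0] with y hy
  have h6 := intervalIntegral.integral_comp_mul_right (a := 1/m) (b := 1) F hy.ne'
  rw [intervalIntegral.integral_div, h6, one_mul, smul_eq_mul, one_div_mul_eq_div]
  generalize (∫ u in (y / m)..y, F u) = q
  have := (hpos y).ne'
  field_simp

lemma gw_intsum (F : ℝ → ℝ) (hpos : ∀ x, 0 < F x) (hi : IntegrableOn F (Set.Ioi 0))
    (m : ℝ) (hm1 : 1 < m) (x : ℝ) (hx : 0 < x) :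
    HasSum (fun i : ℕ => m ^ i * (1 / (m ^ (i+1) * x * Real.log m) *
      ∫ u in (m ^ (i+1) * x / m)..(m ^ (i+1) * x), F u))
      (1 / (m * Real.log m) * x⁻¹ * ∫ u in Set.Ioi x, F u) := by
  have hm0 : 0 < m := by linarith
  have hlog := Real.log_pos hm1
  have h1 : ∀ i : ℕ, m ^ i * (1 / (m ^ (i+1) * x * Real.log m) *
      ∫ u in (m ^ (i+1) * x / m)..(m ^ (i+1) * x), F u) =
      1 / (m * Real.log m) * x⁻¹ * ∫ u in (m ^ i * x)..(m ^ (i+1) * x), F u := by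
    intro i
    have : m ^ (i+1) * x / m = m ^ i * x := by rw [pow_succ]; field_simp
    rw [this]
    generalize (∫ u in (m ^ i * x)..(m ^ (i+1) * x), F u) = q
    rw [pow_succ]
    field_simp
  simp only [h1]
  refine HasSum.mul_left _ ?_
  have hii : ∀ a b : ℝ, 0 < a → 0 < b → IntervalIntegrable F volume a b := by
    intro a b ha hb
    refine (hi.mono_set fun u hu => ?_).intervalIntegrable
    exact lt_of_lt_of_le (lt_min ha hb) hu.1
  rw [hasSum_iff_tendsto_nat_of_nonneg]
  · have h2 : ∀ n : ℕ, ∑ i ∈ Finset.range n, ∫ u in (m ^ i * x)..(m ^ (i+1) * x), F u =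
        ∫ u in x..(m ^ n * x), F u := by
      intro n
      rw [intervalIntegral.sum_integral_adjacent_intervals (a := fun i => m ^ i * x)
        (fun k _ => hii _ _ (by positivity) (by positivity))]
      simp
    simp only [h2]
    exact intervalIntegral_tendsto_integral_Ioi x (hi.mono_set (Set.Ioi_subset_Ioi hx.le))
      ((tendsto_pow_atTop_atTop_of_one_lt hm1).atTop_mul_const hx)
  · intro i
    refine intervalIntegral.integral_nonneg ?_ fun u _ => (hpos u).le
    gcongr
    · exact hm1.le
    · omega

lemma gw_S_facts (F : ℝ → ℝ) (hanti : Antitone F) (hpos : ∀ x, 0 < F x)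
    (hi : IntegrableOn F (Set.Ioi 0))
    (hRV : ∀ lam > (0 : ℝ), Tendsto (fun x => F (lam * x) / F x) atTop (nhds lam⁻¹))
    (m : ℝ) (hm1 : 1 < m) :
    (∀ᶠ x in atTop, 0 < ∑' i : ℕ, m ^ i * F (m ^ (i + 1) * x)) ∧
    (∀ lam > (0:ℝ), Tendsto (fun x => (∑' i : ℕ, m ^ i * F (m ^ (i + 1) * (lam * x))) /
      (∑' i : ℕ, m ^ i * F (m ^ (i + 1) * x))) atTop (nhds lam⁻¹)) ∧
    Tendsto (fun x : ℝ => (∑' i : ℕ, m ^ i * F (m ^ (i + 1) * x)) /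
        (1 / (m * Real.log m) * x⁻¹ * ∫ u in Set.Ioi x, F u))
      atTop (nhds 1) := by
  have hm0 : 0 < m := by linarith
  obtain ⟨hs, ht⟩ := gw_sumlem hm1 (fun y => 1 / (y * Real.log m) * ∫ u in (y / m)..y, F u) F
    (fun x => 1 / (m * Real.log m) * x⁻¹ * ∫ u in Set.Ioi x, F u)
    (Eventually.of_forall hpos) (gw_F1 F hanti hpos hRV m hm1) (by
      filter_upwards [eventually_gt_atTop 0] with x hx
      exact gw_intsum F hpos hi m hm1 x hx)
  refine ⟨?_, ?_, ?_⟩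
  · filter_upwards [hs] with x hx
    exact hx.tsum_pos (fun i => by have := hpos (m ^ (i+1) * x); positivity) 0
      (by have := hpos (m ^ (0+1) * x); positivity)
  · intro lam hlam
    have h1 : Tendsto (fun y => (fun y => lam * F (lam * y)) y / F y) atTop (nhds 1) := by
      have := (hRV lam hlam).const_mul lam
      rw [mul_inv_cancel₀ hlam.ne'] at this
      refine this.congr fun y => ?_
      ring
    have h2 := (gw_sumlem hm1 (fun y => lam * F (lam * y)) F
      (fun x => lam * ∑' i : ℕ, m ^ i * F (m ^ (i + 1) * (lam * x)))
      (Eventually.of_forall hpos) h1 (by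
        have h3 : Tendsto (fun x : ℝ => lam * x) atTop atTop := tendsto_id.const_mul_atTop hlam
        filter_upwards [h3.eventually hs] with x hx
        refine (hx.hasSum.mul_left lam).congr_fun fun i => ?_
        rw [show lam * (m ^ (i+1) * x) = m ^ (i+1) * (lam * x) by ring]
        ring)).2
    have h4 := h2.const_mul lam⁻¹
    rw [mul_one] at h4
    refine h4.congr fun x => ?_
    rw [mul_div_assoc, inv_mul_cancel_left₀ hlam.ne']
  · have := ht.inv₀ one_ne_zero
    rw [inv_one] at this
    refine this.congr fun x => ?_
    rw [inv_div]

lemma gw_pi_meas {α : Type*} {M : MeasurableSpace α} (a : ℕ → α → ℕ)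
    (ha : ∀ i, Measurable (a i)) : Measurable (fun ω i => a i ω) := measurable_pi_iff.2 ha

lemma gw_rsum_meas {α : Type*} {M : MeasurableSpace α} (N : α → ℕ) (a : ℕ → α → ℕ)
    (hN : Measurable N) (ha : ∀ i, Measurable (a i)) :
    Measurable (fun ω => ∑ i ∈ Finset.range (N ω), a i ω) := by
  have h1 : Measurable (fun p : ℕ × α => ∑ i ∈ Finset.range p.1, a i p.2) :=
    measurable_from_prod_countable_right fun k => by
      simpa using Finset.measurable_sum (Finset.range k) fun i _ => ha i
  exact h1.comp (hN.prodMk measurable_id)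

lemma gw_Z_meas {Ω : Type*} [M : MeasurableSpace Ω]
    (ξ : ℕ → ℕ → Ω → ℕ) (hmeas : ∀ n i, Measurable (ξ n i))
    (Z : ℕ → Ω → ℕ) (hZ0 : ∀ ω, Z 0 ω = 1)
    (hZrec : ∀ n ω, Z (n + 1) ω = ∑ i ∈ Finset.range (Z n ω), ξ n i ω) (n : ℕ) :
    Measurable[⨆ p ∈ {p : ℕ × ℕ | p.1 < n}, MeasurableSpace.comap (ξ p.1 p.2) ⊤] (Z n) := by
  induction n with
  | zero =>
    have : Z 0 = fun _ => 1 := funext hZ0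
    rw [this]
    exact @measurable_const _ _ _ _ _
  | succ n ih =>
    have : Z (n+1) = fun ω => ∑ i ∈ Finset.range (Z n ω), ξ n i ω := funext (hZrec n)
    rw [this]
    refine gw_rsum_meas _ _ ?_ ?_
    · refine Measurable.mono ih ?_ le_rfl
      exact biSup_mono fun p (hp : p.1 < n) => Nat.lt_succ_of_lt hp
    · intro i
      refine Measurable.mono (comap_measurable (ξ n i)) ?_ le_rfl
      exact le_biSup (fun p : ℕ × ℕ => MeasurableSpace.comap (ξ p.1 p.2) ⊤)
        (show (n, i) ∈ {p : ℕ × ℕ | p.1 < n + 1} from Nat.lt_succ_self n)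

lemma gw_Z_meas0 {Ω : Type*} [MeasurableSpace Ω]
    (ξ : ℕ → ℕ → Ω → ℕ) (hmeas : ∀ n i, Measurable (ξ n i))
    (Z : ℕ → Ω → ℕ) (hZ0 : ∀ ω, Z 0 ω = 1)
    (hZrec : ∀ n ω, Z (n + 1) ω = ∑ i ∈ Finset.range (Z n ω), ξ n i ω) (n : ℕ) :
    Measurable (Z n) := by
  refine (gw_Z_meas ξ hmeas Z hZ0 hZrec n).mono ?_ le_rfl
  exact iSup₂_le fun p _ => (hmeas p.1 p.2).comap_le

lemma gw_gf {Ω : Type*} [MeasurableSpace Ω] (μ : Measure Ω) [IsProbabilityMeasure μ]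
    (ξ : ℕ → ℕ → Ω → ℕ)
    (hmeas : ∀ n i, Measurable (ξ n i))
    (hindep : iIndepFun (fun p : ℕ × ℕ => ξ p.1 p.2) μ)
    (hident : ∀ n i, Measure.map (ξ n i) μ = Measure.map (ξ 0 0) μ)
    (Z : ℕ → Ω → ℕ)
    (hZ0 : ∀ ω, Z 0 ω = 1)
    (hZrec : ∀ n ω, Z (n + 1) ω = ∑ i ∈ Finset.range (Z n ω), ξ n i ω)
    (t : ℝ) (ht0 : 0 ≤ t) (ht1 : t ≤ 1) (n : ℕ) :
    ∫ ω, t ^ (Z (n+1) ω) ∂μ = ∫ ω, (∫ ω, t ^ (ξ 0 0 ω) ∂μ) ^ (Z n ω) ∂μ := by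
  have hZm := gw_Z_meas0 ξ hmeas Z hZ0 hZrec n
  have hYm : Measurable (fun ω i => ξ n i ω) := measurable_pi_iff.2 fun i => hmeas n i
  have hind : IndepFun (Z n) (fun ω i => ξ n i ω) μ := by
    rw [IndepFun_iff_Indep]
    have h1 := (iIndepFun_iff_iIndep _ _ _).1 hindep
    have h2 := indep_iSup_of_disjoint (fun p : ℕ × ℕ => (hmeas p.1 p.2).comap_le) h1
      (S := {p : ℕ × ℕ | p.1 < n}) (T := {p : ℕ × ℕ | p.1 = n}) (by
        rw [Set.disjoint_left]
        intro p (hp : p.1 < n) (hp2 : p.1 = n)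
        omega)
    refine indep_of_indep_of_le h2 ?_ ?_
    · exact (gw_Z_meas ξ hmeas Z hZ0 hZrec n).comap_le
    · refine Measurable.comap_le ?_
      refine gw_pi_meas _ fun i => ?_
      refine Measurable.mono (comap_measurable (ξ n i)) ?_ le_rfl
      exact le_biSup (fun p : ℕ × ℕ => MeasurableSpace.comap (ξ p.1 p.2) ⊤)
        (show (n, i) ∈ {p : ℕ × ℕ | p.1 = n} from rfl)
  have hmap := (indepFun_iff_map_prod_eq_prod_map_map hZm.aemeasurable hYm.aemeasurable).1 hind
  let h : ℕ × (ℕ → ℕ) → ℝ := fun p => t ^ (∑ i ∈ Finset.range p.1, p.2 i)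
  have hpm : Measurable (fun k : ℕ => t ^ k) := measurable_of_countable _
  have hhm : Measurable h := hpm.comp
    (gw_rsum_meas (α := ℕ × (ℕ → ℕ)) (fun p => p.1) (fun i p => p.2 i) measurable_fst
      (fun i => (measurable_pi_apply i).comp measurable_snd))
  have : IsProbabilityMeasure (μ.map (Z n)) := Measure.isProbabilityMeasure_map hZm.aemeasurable
  have : IsProbabilityMeasure (μ.map (fun ω i => ξ n i ω)) :=
    Measure.isProbabilityMeasure_map hYm.aemeasurable
  have h1 : ∫ ω, t ^ (Z (n+1) ω) ∂μ = ∫ p, h p ∂(μ.map (fun ω => (Z n ω, fun i => ξ n i ω))) := by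
    rw [integral_map (hZm.prodMk hYm).aemeasurable hhm.aestronglyMeasurable]
    simp only [h, hZrec]
  rw [h1, hmap, integral_prod _ (Integrable.of_bound (C := 1) hhm.aestronglyMeasurable
    (Eventually.of_forall fun p => by
      simp only [h]
      rw [Real.norm_of_nonneg (by positivity)]
      exact pow_le_one₀ ht0 ht1))]
  have h2 : ∀ k : ℕ, ∫ y, h (k, y) ∂(μ.map (fun ω i => ξ n i ω)) = (∫ ω, t ^ (ξ 0 0 ω) ∂μ) ^ k := by
    intro k
    rw [integral_map hYm.aemeasurable 
      (show Measurable (fun y => h (k, y)) from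
        hhm.comp measurable_prodMk_left).aestronglyMeasurable]
    simp only [h]
    have h3 : ∀ ω, t ^ (∑ i ∈ Finset.range k, ξ n i ω) = ∏ i : Fin k, t ^ (ξ n i ω) := by
      intro ω
      rw [← Finset.prod_pow_eq_pow_sum, Finset.prod_range]
    simp only [h3]
    have h4 := (hindep.precomp (g := fun i : Fin k => (n, (i : ℕ))) (fun i j hij => by
      simpa [Fin.ext_iff] using hij)).integral_fun_prod_comp (f := fun _ a => t ^ a)
      (fun i => (hmeas _ _).aemeasurable) (fun i => hpm.aestronglyMeasurable)
    refine h4.trans ?_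
    have h5 : ∀ i : Fin k, ∫ ω, t ^ (ξ n i ω) ∂μ = ∫ ω, t ^ (ξ 0 0 ω) ∂μ := by
      intro i
      rw [← integral_map (f := fun a : ℕ => t ^ a) (hmeas n i).aemeasurable hpm.aestronglyMeasurable,
        hident, integral_map (hmeas 0 0).aemeasurable hpm.aestronglyMeasurable]
    simp only [h5]
    simp
  simp only [h2]
  rw [integral_map hZm.aemeasurable (measurable_of_countable _).aestronglyMeasurable]

lemma gw_gf2 {Ω : Type*} [MeasurableSpace Ω] (μ : Measure Ω) [IsProbabilityMeasure μ]
    (ξ : ℕ → ℕ → Ω → ℕ)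
    (hmeas : ∀ n i, Measurable (ξ n i))
    (hindep : iIndepFun (fun p : ℕ × ℕ => ξ p.1 p.2) μ)
    (hident : ∀ n i, Measure.map (ξ n i) μ = Measure.map (ξ 0 0) μ)
    (Z : ℕ → Ω → ℕ)
    (hZ0 : ∀ ω, Z 0 ω = 1)
    (hZrec : ∀ n ω, Z (n + 1) ω = ∑ i ∈ Finset.range (Z n ω), ξ n i ω)
    (n : ℕ) : ∀ (t : ℝ) (_ : 0 ≤ t) (_ : t ≤ 1),
    ∫ ω, t ^ (Z (n+1) ω) ∂μ = ∫ ω, (∫ ω, t ^ (Z n ω) ∂μ) ^ (ξ 0 0 ω) ∂μ := by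
  induction n with
  | zero =>
    intro t ht0 ht1
    rw [gw_gf μ ξ hmeas hindep hident Z hZ0 hZrec t ht0 ht1]
    simp [hZ0]
  | succ n ih =>
    intro t ht0 ht1
    have hpm : Measurable (fun k : ℕ => t ^ k) := measurable_of_countable _
    rw [gw_gf μ ξ hmeas hindep hident Z hZ0 hZrec t ht0 ht1, ih,
      gw_gf μ ξ hmeas hindep hident Z hZ0 hZrec t ht0 ht1]
    · exact integral_nonneg fun ω => by positivity
    · have : ∫ ω, t ^ (ξ 0 0 ω) ∂μ ≤ ∫ ω, (1:ℝ) ∂μ := by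
        refine integral_mono_of_nonneg (Eventually.of_forall fun ω => by
          simp only [Pi.zero_apply]; positivity) (integrable_const _)
          (Eventually.of_forall fun ω => pow_le_one₀ ht0 ht1)
      simpa using this

lemma gw_ylog_le (y s : ℝ) (hy : y = 0 ∨ 1 ≤ y) (hs : 0 ≤ s) :
    0 ≤ y * Real.log (1 + s * y) ∧
    y * Real.log (1 + s * y) ≤ y * Real.log (1 + s) + y * Real.log 2 + y * Real.log y := by
  rcases hy with rfl | hy
  · simp
  · have hy0 : 0 < y := by linarith
    refine ⟨mul_nonneg hy0.le (Real.log_nonneg (by nlinarith [mul_nonneg hs hy0.le])), ?_⟩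
    rw [← mul_add, ← mul_add]
    gcongr
    rw [← Real.log_mul (by positivity) (by positivity), ← Real.log_mul (by positivity) (by positivity)]
    apply Real.log_le_log (by positivity)
    nlinarith [mul_nonneg hs hy0.le]

lemma gw_ylog_int {Ω : Type*} [MeasurableSpace Ω] (μ : Measure Ω) [IsProbabilityMeasure μ]
    (N : Ω → ℕ) (hN : Measurable N) (hint : Integrable (fun ω => (N ω : ℝ)) μ)
    (hlog : Integrable (fun ω => (N ω : ℝ) * Real.log (N ω : ℝ)) μ) (s : ℝ) (hs : 0 ≤ s) :
    Integrable (fun ω => (N ω : ℝ) * Real.log (1 + s * (N ω : ℝ))) μ := by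
  have hm : Measurable (fun ω => (N ω : ℝ) * Real.log (1 + s * (N ω : ℝ))) :=
    (measurable_of_countable (fun k : ℕ => (k : ℝ) * Real.log (1 + s * (k : ℝ)))).comp hN
  refine Integrable.mono' (((hint.mul_const (Real.log (1 + s))).add (hint.mul_const (Real.log 2))).add hlog)
    hm.aestronglyMeasurable (Eventually.of_forall fun ω => ?_)
  have h := gw_ylog_le (N ω) s (by
    rcases Nat.eq_zero_or_pos (N ω) with h | h
    · left; simp [h]
    · right; exact_mod_cast h) hs
  rw [Real.norm_of_nonneg h.1]
  exact h.2

lemma gw_pt (m s u y : ℝ) (n : ℕ) (hy : y = n) (hm1 : 1 < m) (hs : 0 < s) (hu0 : 0 ≤ u) (hu1 : u ≤ 1)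
    (hus : u ≤ s / m) :
    0 ≤ (1 - u) ^ n - 1 + u * y ∧
    (1 - u) ^ n - 1 + u * y ≤ s / (m - 1) * (y * Real.log (1 + s * y)) -
      s / (m - 1) * (y * Real.log (1 + s / m * y)) := by
  have hm0 : 0 < m := by linarith
  have hy0 : 0 ≤ y := by rw [hy]; positivity
  constructor
  · have := one_add_mul_le_pow (a := -u) (by linarith) n
    rw [hy]
    have h2 : (1 + -u) = 1 - u := by ring
    rw [h2] at this
    linarith
  · have h1 : (1 - u) ^ n ≤ Real.exp (-(u * y)) := by
      have h2 : 1 - u ≤ Real.exp (-u) := by linarith [Real.add_one_le_exp (-u)]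
      calc (1 - u) ^ n ≤ (Real.exp (-u)) ^ n := pow_le_pow_left₀ (by linarith) h2 n
        _ = _ := by rw [← Real.exp_nat_mul, hy]; congr 1; ring
    have hx0 : 0 ≤ u * y := by positivity
    have h2 : Real.exp (-(u * y)) ≤ 1 / (1 + u * y) := by
      rw [Real.exp_neg, ← one_div]
      gcongr
      linarith [Real.add_one_le_exp (u * y)]
    set v := s / m * y with hv
    have hv0 : 0 ≤ v := by positivity
    have hxv : u * y ≤ v := by rw [hv]; gcongr
    have h3 : (1 - u) ^ n - 1 + u * y ≤ v * (v / (1 + v)) := by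
      calc (1 - u) ^ n - 1 + u * y ≤ 1 / (1 + u * y) - 1 + u * y := by linarith
        _ = u * y - u * y / (1 + u * y) := by field_simp; ring
        _ ≤ v - v / (1 + v) := by
          rw [← sub_nonneg]
          have : v - v / (1 + v) - (u * y - u * y / (1 + u * y)) =
            (v - u * y) * (v + u * y + v * (u * y)) / ((1 + v) * (1 + u * y)) := by
            field_simp; ring
          rw [this]
          have : 0 ≤ v - u * y := by linarith
          positivity
        _ = v * (v / (1 + v)) := by field_simp; ring
    refine h3.trans ?_
    have hsy : s * y = m * v := by rw [hv]; field_simp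
    rw [← mul_sub, ← mul_sub, hsy, ← Real.log_div (by positivity) (by positivity)]
    have h4 := Real.one_sub_inv_le_log_of_pos (show 0 < (1 + m * v) / (1 + v) by positivity)
    have h5 : (m - 1) * v / (m * (1 + v)) ≤ 1 - ((1 + m * v) / (1 + v))⁻¹ := by
      have : 1 - ((1 + m * v) / (1 + v))⁻¹ = (m - 1) * v / (1 + m * v) := by
        field_simp; ring
      rw [this]
      have : 0 < m - 1 := by linarith
      gcongr
      nlinarith
    have hm1' : 0 < m - 1 := by linarith
    calc v * (v / (1 + v)) = s / (m - 1) * (y * ((m - 1) * v / (m * (1 + v)))) := by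
          nth_rewrite 1 [hv]; field_simp
      _ ≤ _ := by gcongr; exact h5.trans h4

lemma gw_mean_bound {Ω : Type*} [MeasurableSpace Ω] (μ : Measure Ω) [IsProbabilityMeasure μ]
    (N : Ω → ℕ) (hN : Measurable N) (hint : Integrable (fun ω => (N ω : ℝ)) μ)
    (hlog : Integrable (fun ω => (N ω : ℝ) * Real.log (N ω : ℝ)) μ)
    (m : ℝ) (hm : m = ∫ ω, (N ω : ℝ) ∂μ) (hm1 : 1 < m)
    (φ : ℕ → ℝ → ℝ) (h0 : ∀ s, φ 0 s = Real.exp (-s))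
    (hr : ∀ n s, 0 < s → φ (n+1) s = ∫ ω, (φ n (s / m)) ^ (N ω) ∂μ)
    (hφ0 : ∀ n s, 0 < s → 0 ≤ φ n s) (hφ1 : ∀ n s, 0 < s → φ n s ≤ 1) (n : ℕ) :
    ∀ s, 0 < s → 0 ≤ s - (1 - φ n s) ∧ s - (1 - φ n s) ≤ s ^ 2 / m ^ n +
      s / (m - 1) * ∫ ω, (N ω : ℝ) * Real.log (1 + s * (N ω : ℝ)) ∂μ := by
  have hm0 : 0 < m := by linarith
  have hI0 : ∀ s, 0 < s → 0 ≤ ∫ ω, (N ω : ℝ) * Real.log (1 + s * (N ω : ℝ)) ∂μ := fun s hs =>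
    integral_nonneg fun ω => mul_nonneg (by positivity) (Real.log_nonneg (by
      have : 0 ≤ s * (N ω : ℝ) := by positivity
      linarith))
  have hm1' : 0 < m - 1 := by linarith
  induction n with
  | zero =>
    intro s hs
    rw [h0]
    refine ⟨by linarith [Real.add_one_le_exp (-s)], ?_⟩
    have h2 : Real.exp (-s) ≤ 1 / (1 + s) := by
      rw [Real.exp_neg, ← one_div]
      gcongr
      linarith [Real.add_one_le_exp s]
    have h3 : 1 / (1 + s) ≤ 1 - s + s ^ 2 := by
      rw [div_le_iff₀ (by positivity)]
      nlinarith [pow_pos hs 3]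
    have h4 : 0 ≤ s / (m - 1) * ∫ ω, (N ω : ℝ) * Real.log (1 + s * (N ω : ℝ)) ∂μ :=
      mul_nonneg (by positivity) (hI0 s hs)
    simp only [pow_zero, div_one]
    linarith
  | succ n ih =>
    intro s hs
    have hσ : 0 < s / m := by positivity
    obtain ⟨ih1, ih2⟩ := ih _ hσ
    set u := 1 - φ n (s / m) with hu
    have hφu : φ n (s / m) = 1 - u := by rw [hu]; ring
    have hu0 : 0 ≤ u := by linarith [hφ1 n _ hσ]
    have hu1 : u ≤ 1 := by linarith [hφ0 n _ hσ]
    have hpt := fun ω => gw_pt m s u (N ω) (N ω) rfl hm1 hs hu0 hu1 (by linarith)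
    have hpi : Integrable (fun ω => (1 - u) ^ (N ω)) μ := by
      refine Integrable.of_bound (C := 1) ((measurable_of_countable (fun k : ℕ => (1 - u) ^ k)).comp
        hN).aestronglyMeasurable (Eventually.of_forall fun ω => ?_)
      have h1u : 0 ≤ 1 - u := by linarith
      rw [Real.norm_of_nonneg (by positivity)]
      exact pow_le_one₀ h1u (by linarith)
    have hki : Integrable (fun ω => (1 - u) ^ (N ω) - 1 + u * (N ω : ℝ)) μ :=
      (hpi.sub (integrable_const _)).add (hint.const_mul u)
    have hp1 : Integrable (fun ω => (1 - u) ^ (N ω) - 1) μ := hpi.sub (integrable_const _)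
    have hk : s - (1 - φ (n+1) s) = m * (s / m - u) +
        ∫ ω, ((1 - u) ^ (N ω) - 1 + u * (N ω : ℝ)) ∂μ := by
      rw [integral_add hp1 (hint.const_mul u),
        integral_sub hpi (integrable_const _), integral_const_mul, ← hm, hr n s hs, hφu]
      simp
      field_simp
      ring
    have hi1 := gw_ylog_int μ N hN hint hlog s hs.le
    have hi2 := gw_ylog_int μ N hN hint hlog (s/m) hσ.le
    rw [hk]
    constructor
    · have : 0 ≤ ∫ ω, ((1 - u) ^ (N ω) - 1 + u * (N ω : ℝ)) ∂μ := integral_nonneg fun ω => (hpt ω).1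
      have h2 : 0 ≤ m * (s / m - u) := by positivity
      linarith
    · have h1 := integral_mono hki ((hi1.const_mul (s / (m-1))).sub (hi2.const_mul (s / (m-1))))
        fun ω => (hpt ω).2
      simp only [Pi.sub_apply] at h1
      rw [integral_sub (hi1.const_mul _) (hi2.const_mul _), integral_const_mul, integral_const_mul] at h1
      have h2 : m * (s / m - u) ≤ m * ((s / m) ^ 2 / m ^ n +
        s / m / (m - 1) * ∫ ω, (N ω : ℝ) * Real.log (1 + s / m * (N ω : ℝ)) ∂μ) := by gcongr
      have h3 : ∀ q : ℝ, m * ((s / m) ^ 2 / m ^ n + s / m / (m - 1) * q) =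
          s ^ 2 / m ^ (n+1) + s / (m - 1) * q := by
        intro q
        have h9 : m - 1 ≠ 0 := hm1'.ne'
        generalize m - 1 = r at h9 ⊢
        field_simp
        ring
      rw [h3] at h2
      linarith

lemma gw_mean_one {Ω : Type*} [MeasurableSpace Ω] (μ : Measure Ω) [IsProbabilityMeasure μ]
    (N : Ω → ℕ) (hN : Measurable N) (hint : Integrable (fun ω => (N ω : ℝ)) μ)
    (hlog : Integrable (fun ω => (N ω : ℝ) * Real.log (N ω : ℝ)) μ)
    (m : ℝ) (X : Ω → ℝ) (hX : AEMeasurable X μ) (hX0 : ∀ᵐ ω ∂μ, 0 ≤ X ω)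
    (hb : ∀ s, 0 < s → 0 ≤ s - (1 - ∫ ω, Real.exp (-(s * X ω)) ∂μ) ∧
      s - (1 - ∫ ω, Real.exp (-(s * X ω)) ∂μ) ≤
      s / (m - 1) * ∫ ω, (N ω : ℝ) * Real.log (1 + s * (N ω : ℝ)) ∂μ) :
    Integrable X μ ∧ ∫ ω, X ω ∂μ = 1 := by
  let s : ℕ → ℝ := fun n => 1 / ((n : ℝ) + 1)
  have hs0 : ∀ n, 0 < s n := fun n => by simp only [s]; positivity
  have hs1 : ∀ n, s n ≤ 1 := fun n => by
    simp only [s]; rw [div_le_one (by positivity)]; linarith [Nat.cast_nonneg (α := ℝ) n]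
  have hsl : Tendsto s atTop (nhds 0) := tendsto_one_div_add_atTop_nhds_zero_nat
  let h : ℕ → Ω → ℝ := fun n ω => (1 - Real.exp (-(s n * X ω))) / s n
  have hexpi : ∀ n, Integrable (fun ω => Real.exp (-(s n * X ω))) μ := by
    intro n
    refine Integrable.of_bound (C := 1)
      (Real.measurable_exp.comp_aemeasurable (hX.const_mul _).neg).aestronglyMeasurable ?_
    filter_upwards [hX0] with ω hω
    rw [Real.norm_of_nonneg (Real.exp_pos _).le, Real.exp_le_one_iff]
    have := mul_nonneg (hs0 n).le hω
    linarith
  have hhi : ∀ n, Integrable (h n) μ := fun n => ((integrable_const _).sub (hexpi n)).div_const _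
  have hhI : ∀ n, ∫ ω, h n ω ∂μ = (1 - ∫ ω, Real.exp (-(s n * X ω)) ∂μ) / s n := by
    intro n
    simp only [h]
    rw [integral_div, integral_sub (integrable_const _) (hexpi n)]
    simp
  have hh0 : ∀ n, ∀ᵐ ω ∂μ, 0 ≤ h n ω := by
    intro n
    filter_upwards [hX0] with ω hω
    have h1 := mul_nonneg (hs0 n).le hω
    have : Real.exp (-(s n * X ω)) ≤ 1 := Real.exp_le_one_iff.2 (by linarith)
    exact div_nonneg (by linarith) (hs0 n).le
  have hhX : ∀ n ω, h n ω ≤ X ω := by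
    intro n ω
    have := Real.add_one_le_exp (-(s n * X ω))
    simp only [h]
    rw [div_le_iff₀ (hs0 n)]
    linarith
  have hhl : ∀ ω, Tendsto (fun n => h n ω) atTop (nhds (X ω)) := by
    intro ω
    have hd : HasDerivAt (fun t : ℝ => 1 - Real.exp (-(t * X ω))) (X ω) 0 := by
      have h1 : HasDerivAt (fun t : ℝ => -(t * X ω)) (-(1 * X ω)) 0 :=
        ((hasDerivAt_id (0:ℝ)).mul_const (X ω)).neg
      have h2 := (h1.exp).const_sub 1
      refine h2.congr_deriv ?_
      simp
    have h3 := hd.tendsto_slope_zero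
    have h4 : Tendsto s atTop (nhdsWithin 0 {0}ᶜ) :=
      tendsto_nhdsWithin_iff.2 ⟨hsl, Eventually.of_forall fun n => (hs0 n).ne'⟩
    refine (h3.comp h4).congr fun n => ?_
    simp only [Function.comp, h, zero_add, smul_eq_mul, zero_mul, neg_zero, Real.exp_zero, sub_self, sub_zero]
    field_simp
  have hle1 : ∀ n, ∫ ω, h n ω ∂μ ≤ 1 := by
    intro n
    rw [hhI, div_le_one (hs0 n)]
    linarith [(hb _ (hs0 n)).1]
  have hXi : Integrable X μ := by
    refine ⟨hX.aestronglyMeasurable, ?_⟩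
    rw [hasFiniteIntegral_iff_ofReal hX0]
    have h1 : ∫⁻ ω, ENNReal.ofReal (X ω) ∂μ ≤ liminf (fun n => ∫⁻ ω, ENNReal.ofReal (h n ω) ∂μ) atTop := by
      refine le_trans (le_of_eq ?_) (lintegral_liminf_le' fun n => (hhi n).aemeasurable.ennreal_ofReal)
      refine lintegral_congr fun ω => ?_
      exact (((ENNReal.continuous_ofReal.tendsto _).comp (hhl ω)).liminf_eq).symm
    refine lt_of_le_of_lt (h1.trans (liminf_le_of_le (by isBoundedDefault) (a := 1) fun b hb' => ?_))
      ENNReal.one_lt_top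
    obtain ⟨n, hn⟩ := hb'.exists
    refine hn.trans ?_
    rw [← ofReal_integral_eq_lintegral_ofReal (hhi n) (hh0 n)]
    exact ENNReal.ofReal_le_one.2 (hle1 n)
  refine ⟨hXi, ?_⟩
  have hl1 : Tendsto (fun n => ∫ ω, h n ω ∂μ) atTop (nhds (∫ ω, X ω ∂μ)) := by
    refine tendsto_integral_of_dominated_convergence X (fun n => (hhi n).aestronglyMeasurable) hXi ?_ ?_
    · intro n
      filter_upwards [hh0 n] with ω hω
      rw [Real.norm_of_nonneg hω]
      exact hhX n ω
    · exact Eventually.of_forall hhl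
  have hl2 : Tendsto (fun n => ∫ ω, (N ω : ℝ) * Real.log (1 + s n * (N ω : ℝ)) ∂μ) atTop
      (nhds (∫ ω, (0:ℝ) ∂μ)) := by
    refine tendsto_integral_of_dominated_convergence _
      (fun n => (gw_ylog_int μ N hN hint hlog (s n) (hs0 n).le).aestronglyMeasurable)
      (gw_ylog_int μ N hN hint hlog 1 zero_le_one) ?_ ?_
    · intro n
      refine Eventually.of_forall fun ω => ?_
      have h0 : 0 ≤ s n * (N ω : ℝ) := mul_nonneg (hs0 n).le (by positivity)
      rw [Real.norm_of_nonneg (mul_nonneg (by positivity) (Real.log_nonneg (by linarith)))]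
      gcongr
      exact hs1 n
    · refine Eventually.of_forall fun ω => ?_
      have h1 : Tendsto (fun n => 1 + s n * (N ω : ℝ)) atTop (nhds 1) := by
        simpa using (hsl.mul_const (N ω : ℝ)).const_add 1
      have h2 := ((Real.continuousAt_log one_ne_zero).tendsto.comp h1).const_mul (N ω : ℝ)
      simpa [Function.comp_def] using h2
  rw [integral_zero] at hl2
  have hl3 : Tendsto (fun n => ∫ ω, h n ω ∂μ) atTop (nhds 1) := by
    have h4 := (hl2.const_mul (1 / (m - 1))).const_sub 1
    rw [mul_zero, sub_zero] at h4
    refine tendsto_of_tendsto_of_tendsto_of_le_of_le h4 tendsto_const_nhds (fun n => ?_) hle1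
    have h5 := (hb _ (hs0 n)).2
    show _ ≤ ∫ ω, h n ω ∂μ
    rw [hhI, le_div_iff₀ (hs0 n)]
    have h6 : ∀ q : ℝ, (1 - 1 / (m-1) * q) * s n = s n - s n / (m - 1) * q := by intro q; ring
    rw [h6]
    linarith
  exact tendsto_nhds_unique hl1 hl3

theorem gw_regvar_index_neg_one_limit
    {Ω : Type*} [MeasurableSpace Ω] (μ : Measure Ω) [IsProbabilityMeasure μ]
    (ξ : ℕ → ℕ → Ω → ℕ)
    (hmeas : ∀ n i, Measurable (ξ n i))
    (hindep : iIndepFun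
      (fun p : ℕ × ℕ => ξ p.1 p.2) μ)
    (hident : ∀ n i, Measure.map (ξ n i) μ = Measure.map (ξ 0 0) μ)
    (hint : Integrable (fun ω => (ξ 0 0 ω : ℝ)) μ)
    (m : ℝ) (hm : m = ∫ ω, (ξ 0 0 ω : ℝ) ∂μ) (hm1 : 1 < m)
    (Z : ℕ → Ω → ℕ)
    (hZ0 : ∀ ω, Z 0 ω = 1)
    (hZrec : ∀ n ω, Z (n + 1) ω = ∑ i ∈ Finset.range (Z n ω), ξ n i ω)
    (W : ℕ → Ω → ℝ) (hW : ∀ n ω, W n ω = (Z n ω : ℝ) / m ^ n)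
    (Fbar : ℝ → ℝ) (hFbar : ∀ x, Fbar x = (μ {ω | x < (ξ 0 0 ω : ℝ)}).toReal)
    (Wlim : Ω → ℝ)
    (hWlim : ∀ᵐ ω ∂μ, Tendsto (fun n => W n ω) atTop (nhds (Wlim ω)))
    -- `E(ξ log ξ) < ∞`
    (hmomlog : Integrable (fun ω => (ξ 0 0 ω : ℝ) * Real.log (ξ 0 0 ω : ℝ)) μ)
    -- `F̄` is regularly varying with index `-1`
    (hRV : ∀ lam > (0 : ℝ),
      Tendsto (fun x => Fbar (lam * x) / Fbar x) atTop (nhds (lam ^ (-1 : ℝ)))) :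
    Tendsto (fun x : ℝ => (μ {ω | x < Wlim ω}).toReal /
        (∑' i : ℕ, m ^ i * Fbar (m ^ (i + 1) * x))) atTop (nhds 1) ∧
    Tendsto (fun x : ℝ => (∑' i : ℕ, m ^ i * Fbar (m ^ (i + 1) * x)) /
        (1 / (m * Real.log m) * x⁻¹ * ∫ u in Set.Ioi x, Fbar u))
      atTop (nhds 1) := by
  have hm0 : 0 < m := by linarith
  have hRV' : ∀ lam > (0 : ℝ), Tendsto (fun x => Fbar (lam * x) / Fbar x) atTop (nhds lam⁻¹) := by
    intro lam hlam
    have := hRV lam hlam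
    rwa [Real.rpow_neg_one] at this
  have hanti : Antitone Fbar := by
    intro x y hxy
    rw [hFbar, hFbar]
    exact ENNReal.toReal_mono (measure_ne_top _ _)
      (measure_mono fun ω (h : y < (ξ 0 0 ω : ℝ)) => lt_of_le_of_lt hxy h)
  have hpos : ∀ x, 0 < Fbar x := by
    intro x
    have h1 := hRV' 1 one_pos
    rw [inv_one] at h1
    obtain ⟨y, hy, hxy⟩ := ((h1.eventually (Ioi_mem_nhds (zero_lt_one))).and (eventually_ge_atTop x)).exists
    have h2 : Fbar y ≠ 0 := by
      intro h0
      simp [h0] at hy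
    have h3 : 0 ≤ Fbar y := by rw [hFbar]; exact ENNReal.toReal_nonneg
    exact (lt_of_le_of_ne h3 h2.symm).trans_le (hanti hxy)
  have hY : Measurable (fun ω => (ξ 0 0 ω : ℝ)) :=
    (measurable_of_countable (fun k : ℕ => (k : ℝ))).comp (hmeas 0 0)
  have hY0 : ∀ ω, (0:ℝ) ≤ (ξ 0 0 ω : ℝ) := fun ω => by positivity
  have hFi := gw_Fint μ _ hY0 hint Fbar hFbar hanti
  obtain ⟨hS1, hS2, hS3⟩ := gw_S_facts Fbar hanti hpos hFi hRV' m hm1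
  refine ⟨?_, hS3⟩
  have hZm := gw_Z_meas0 ξ hmeas Z hZ0 hZrec
  have hWm : ∀ n, Measurable (W n) := by
    intro n
    rw [show W n = fun ω => (Z n ω : ℝ) / m ^ n from funext (hW n)]
    exact (measurable_of_countable (fun k : ℕ => (k : ℝ) / m ^ n)).comp (hZm n)
  have hX : AEMeasurable Wlim μ := aemeasurable_of_tendsto_metrizable_ae atTop
    (fun n => (hWm n).aemeasurable) hWlim
  have hW0 : ∀ n ω, 0 ≤ W n ω := fun n ω => by rw [hW]; positivity
  have hX0 : ∀ᵐ ω ∂μ, 0 ≤ Wlim ω := by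
    filter_upwards [hWlim] with ω hω
    exact ge_of_tendsto' hω fun n => hW0 n ω
  let φ : ℕ → ℝ → ℝ := fun n s => ∫ ω, (Real.exp (-(s / m ^ n))) ^ (Z n ω) ∂μ
  have hφW : ∀ n s, φ n s = ∫ ω, Real.exp (-(s * W n ω)) ∂μ := by
    intro n s
    refine integral_congr_ae (Eventually.of_forall fun ω => ?_)
    simp only
    rw [← Real.exp_nat_mul, hW]
    congr 1
    ring
  have hφnn : ∀ n s, 0 ≤ φ n s := fun n s => integral_nonneg fun ω => by positivity
  have hφ1 : ∀ n s, 0 < s → φ n s ≤ 1 := by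
    intro n s hs
    have : φ n s ≤ ∫ ω, (1:ℝ) ∂μ := by
      refine integral_mono_of_nonneg (Eventually.of_forall fun ω => by
        simp only [Pi.zero_apply]; positivity) (integrable_const _)
        (Eventually.of_forall fun ω => pow_le_one₀ (Real.exp_pos _).le
          (Real.exp_le_one_iff.2 (neg_nonpos.2 (by positivity))))
    simpa using this
  have hφ0 : ∀ s, φ 0 s = Real.exp (-s) := by
    intro s
    simp [φ, hZ0]
  have hφr : ∀ n s, 0 < s → φ (n+1) s = ∫ ω, (φ n (s / m)) ^ (ξ 0 0 ω) ∂μ := by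
    intro n s hs
    have h1 := gw_gf2 μ ξ hmeas hindep hident Z hZ0 hZrec n (Real.exp (-(s / m ^ (n+1))))
      (Real.exp_pos _).le (Real.exp_le_one_iff.2 (neg_nonpos.2 (by positivity)))
    have h2 : s / m / m ^ n = s / m ^ (n+1) := by rw [div_div, pow_succ']
    simp only [φ, h2]
    exact h1
  have hφl : ∀ s, 0 < s → Tendsto (fun n => φ n s) atTop (nhds (∫ ω, Real.exp (-(s * Wlim ω)) ∂μ)) := by
    intro s hs
    simp only [hφW]
    refine tendsto_integral_of_dominated_convergence (fun _ => (1:ℝ)) (fun n =>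
      (Real.measurable_exp.comp ((hWm n).const_mul s).neg).aestronglyMeasurable) (integrable_const _) ?_ ?_
    · intro n
      refine Eventually.of_forall fun ω => ?_
      have := mul_nonneg hs.le (hW0 n ω)
      rw [Real.norm_of_nonneg (Real.exp_pos _).le, Real.exp_le_one_iff]
      linarith
    · filter_upwards [hWlim] with ω hω
      exact (Real.continuous_exp.tendsto _).comp (hω.const_mul s).neg
  have hbd := gw_mean_bound μ (ξ 0 0) (hmeas 0 0) hint hmomlog m hm hm1 φ hφ0 hφr
    (fun n s _ => hφnn n s) hφ1
  obtain ⟨hXi, hX1⟩ := gw_mean_one μ (ξ 0 0) (hmeas 0 0) hint hmomlog m Wlim hX hX0 (by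
    intro s hs
    have h1 := ((hφl s hs).const_sub 1).const_sub s
    refine ⟨ge_of_tendsto' h1 fun n => (hbd n s hs).1, ?_⟩
    have h2 : Tendsto (fun n : ℕ => s ^ 2 / m ^ n +
      s / (m - 1) * ∫ ω, (ξ 0 0 ω : ℝ) * Real.log (1 + s * (ξ 0 0 ω : ℝ)) ∂μ) atTop
      (nhds (0 + s / (m - 1) * ∫ ω, (ξ 0 0 ω : ℝ) * Real.log (1 + s * (ξ 0 0 ω : ℝ)) ∂μ)) :=
      ((tendsto_pow_atTop_atTop_of_one_lt hm1).const_div_atTop (s ^ 2)).add_const _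
    rw [zero_add] at h2
    exact le_of_tendsto_of_tendsto' h1 h2 fun n => (hbd n s hs).2)
  have hfe : ∀ s > 0, ∫ ω, Real.exp (-(s * Wlim ω)) ∂μ =
      ∫ ω, Real.exp (-(-Real.log (∫ ω, Real.exp (-(s / m * Wlim ω)) ∂μ) * (ξ 0 0 ω : ℝ))) ∂μ := by
    intro s hs
    have hσ : 0 < s / m := by positivity
    have hΦpos : 0 < ∫ ω, Real.exp (-(s / m * Wlim ω)) ∂μ := by
      refine integral_exp_pos ?_
      have := gw_lap_int μ Wlim hX hX0 0 (s / m) hσ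
      simpa using this
    have h1 := (hφl s hs).comp (tendsto_add_atTop_nat 1)
    have h2 : Tendsto (fun n => φ (n+1) s) atTop
        (nhds (∫ ω, (∫ ω, Real.exp (-(s / m * Wlim ω)) ∂μ) ^ (ξ 0 0 ω) ∂μ)) := by
      simp only [fun n => hφr n s hs]
      refine tendsto_integral_of_dominated_convergence (fun _ => (1:ℝ)) (fun n =>
        ((measurable_of_countable (fun k : ℕ => (φ n (s / m)) ^ k)).comp
          (hmeas 0 0)).aestronglyMeasurable) (integrable_const _) ?_ ?_
      · intro n
        refine Eventually.of_forall fun ω => ?_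
        rw [Real.norm_of_nonneg (pow_nonneg (hφnn _ _) _)]
        exact pow_le_one₀ (hφnn _ _) (hφ1 _ _ hσ)
      · exact Eventually.of_forall fun ω => (hφl _ hσ).pow _
    rw [tendsto_nhds_unique h1 h2]
    refine integral_congr_ae (Eventually.of_forall fun ω => ?_)
    simp only
    rw [neg_mul, neg_neg, mul_comm, Real.exp_nat_mul, Real.exp_log hΦpos]
  have hcore := gw_core μ Wlim (fun ω => (ξ 0 0 ω : ℝ)) hX0 hXi hX1 hY hY0 hint (fun ω => by
    have : ξ 0 0 ω ≤ ξ 0 0 ω ^ 2 := Nat.le_self_pow (by norm_num) _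
    exact_mod_cast this) m hm hm1 hfe Fbar hFbar hpos hRV'
  exact gw_taub μ Wlim hX hX0 (fun x => ∑' i : ℕ, m ^ i * Fbar (m ^ (i + 1) * x)) hS1 hS2 hcore
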